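/- arXiv:2306.17777 — 5 statements merged into one kernel-verified Lean document; each statement's English description precedes it below -/
import Mathlib

section
/- For every integer k ≥ 1 there is a constant c (depending only on k) such that for every finite simple graph G of rank width at most k on n vertices there is a sentence φ_G of first-order logic with counting quantifiers using at most 6k+4 variables and quantifier depth at most c·(log₂ n + 1) that characterizes G up to isomorphism: G ⊨ φ_G, and for every finite simple graph H with H ≇ G, H ⊭ φ_G. -/
/-!
Statement 2: graphs of rank width ≤ k are characterized up to isomorphism by sentences of
first-order logic with counting using 6k+4 variables and quantifier depth O(log n).
-/

open Classical in
/-- `ρ_G(X)`: the `F₂`-rank of the `X × X̄` cut matrix `M(X, X̄)` whose `(u, w)` entry is `1`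
iff `uw ∈ E(G)`. -/
noncomputable def cutRank {V : Type} [Fintype V] [DecidableEq V] (G : SimpleGraph V)
    (X : Finset V) : ℕ :=
  (Matrix.of fun (u : ↥X) (w : ↥(Xᶜ)) => if G.Adj ↑u ↑w then (1 : ZMod 2) else 0).rank

/-- Binary rooted trees with leaves labelled by vertices.  Such a tree `T` (with each vertex
occurring at exactly one leaf) determines a rank decomposition `(T, γ)`, where `γ(t)` is the
set of leaf labels below `t`. -/
inductive RWTree (V : Type) : Type
  | leaf : V → RWTree V
  | node : RWTree V → RWTree V → RWTree V

namespace RWTree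

/-- The multiset of leaf labels of a tree, i.e. `γ(t)` (with multiplicities). -/
def leaves {V : Type} : RWTree V → Multiset V
  | leaf v => {v}
  | node l r => leaves l + leaves r

/-- The list of all subtrees (one for each node) of a tree. -/
def subtrees {V : Type} : RWTree V → List (RWTree V)
  | leaf v => [leaf v]
  | node l r => node l r :: (subtrees l ++ subtrees r)

end RWTree

/-- `G` has rank width at most `k`. -/
def RankwidthLE {V : Type} [Fintype V] [DecidableEq V] (G : SimpleGraph V) (k : ℕ) : Prop :=
  ∃ t : RWTree V, t.leaves = (Finset.univ : Finset V).val ∧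
    ∀ s ∈ t.subtrees, cutRank G s.leaves.toFinset ≤ k

/-- Formulas of first-order logic with counting quantifiers over the language of graphs,
using (at most) `n` variables `x_0, …, x_{n-1}`.  `count N i φ` is the counting quantifier
`∃^{≥N} x_i φ`.  (The quantifier `∃ !N` ("exactly `N`") is expressible as
`∃^{≥N} ∧ ¬∃^{≥N+1}` without affecting variables or quantifier depth.) -/
inductive CFormula (n : ℕ) : Type
  | eq : Fin n → Fin n → CFormula n
  | adj : Fin n → Fin n → CFormula n
  | not : CFormula n → CFormula n
  | and : CFormula n → CFormula n → CFormula n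
  | or : CFormula n → CFormula n → CFormula n
  | ex : Fin n → CFormula n → CFormula n
  | all : Fin n → CFormula n → CFormula n
  | count : ℕ → Fin n → CFormula n → CFormula n

namespace CFormula

/-- Quantifier depth of a formula. -/
def qdepth {n : ℕ} : CFormula n → ℕ
  | eq _ _ => 0
  | adj _ _ => 0
  | not φ => φ.qdepth
  | and φ ψ => max φ.qdepth ψ.qdepth
  | or φ ψ => max φ.qdepth ψ.qdepth
  | ex _ φ => φ.qdepth + 1
  | all _ φ => φ.qdepth + 1
  | count _ _ φ => φ.qdepth + 1

/-- The free variables of a formula; a sentence is a formula with no free variables. -/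
def freeVars {n : ℕ} : CFormula n → Finset (Fin n)
  | eq i j => {i, j}
  | adj i j => {i, j}
  | not φ => φ.freeVars
  | and φ ψ => φ.freeVars ∪ ψ.freeVars
  | or φ ψ => φ.freeVars ∪ ψ.freeVars
  | ex i φ => φ.freeVars.erase i
  | all i φ => φ.freeVars.erase i
  | count _ i φ => φ.freeVars.erase i

/-- Satisfaction of a formula in a graph `G` under an assignment `α` of the variables. -/
def Sat {n : ℕ} {V : Type} [DecidableEq V] (G : SimpleGraph V) :
    CFormula n → (Fin n → V) → Prop
  | eq i j, α => α i = α j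
  | adj i j, α => G.Adj (α i) (α j)
  | not φ, α => ¬ Sat G φ α
  | and φ ψ, α => Sat G φ α ∧ Sat G ψ α
  | or φ ψ, α => Sat G φ α ∨ Sat G ψ α
  | ex i φ, α => ∃ x : V, Sat G φ (Function.update α i x)
  | all i φ, α => ∀ x : V, Sat G φ (Function.update α i x)
  | count N i φ, α => N ≤ Nat.card {x : V // Sat G φ (Function.update α i x)}

end CFormula


section PartA

/-- The bijective pebble game equivalence. -/
def Eqv {m : ℕ} {V W : Type} (G : SimpleGraph V) (H : SimpleGraph W) :
    ℕ → (Fin m → V) → (Fin m → W) → Prop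
  | 0, α, β => ∀ i j, (α i = α j ↔ β i = β j) ∧ (G.Adj (α i) (α j) ↔ H.Adj (β i) (β j))
  | r + 1, α, β => (∀ i j, (α i = α j ↔ β i = β j) ∧ (G.Adj (α i) (α j) ↔ H.Adj (β i) (β j))) ∧
      ∀ i, ∃ h : V ≃ W, ∀ x, Eqv G H r (Function.update α i x) (Function.update β i (h x))

variable {m : ℕ} {V W U : Type} {G : SimpleGraph V} {H : SimpleGraph W} {K : SimpleGraph U}

theorem Eqv.atom {r : ℕ} {α : Fin m → V} {β : Fin m → W} (h : Eqv G H r α β) (i j) :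
    (α i = α j ↔ β i = β j) ∧ (G.Adj (α i) (α j) ↔ H.Adj (β i) (β j)) := by
  cases r with
  | zero => exact h i j
  | succ r => exact h.1 i j

theorem Eqv.pred {r : ℕ} : ∀ {α : Fin m → V} {β : Fin m → W}, Eqv G H (r + 1) α β →
    Eqv G H r α β := by
  induction r with
  | zero => intro α β h; exact h.1
  | succ r ih =>
    intro α β h
    refine ⟨h.1, fun i => ?_⟩
    obtain ⟨f, hf⟩ := h.2 i
    exact ⟨f, fun x => ih (hf x)⟩

theorem Eqv.mono {r s : ℕ} (hrs : s ≤ r) {α : Fin m → V} {β : Fin m → W} (h : Eqv G H r α β) :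
    Eqv G H s α β := by
  induction r, hrs using Nat.le_induction with
  | base => exact h
  | succ r _ ih => exact ih h.pred

theorem Eqv.rfl_self {r : ℕ} : ∀ (α : Fin m → V), Eqv G G r α α := by
  induction r with
  | zero => intro α i j; simp
  | succ r ih => intro α; exact ⟨fun i j => by simp, fun i => ⟨Equiv.refl _, fun x => ih _⟩⟩

theorem Eqv.symm {r : ℕ} : ∀ {α : Fin m → V} {β : Fin m → W}, Eqv G H r α β →
    Eqv H G r β α := by
  induction r with
  | zero => intro α β h i j; exact ⟨(h i j).1.symm, (h i j).2.symm⟩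
  | succ r ih =>
    intro α β h
    refine ⟨fun i j => ⟨(h.1 i j).1.symm, (h.1 i j).2.symm⟩, fun i => ?_⟩
    obtain ⟨f, hf⟩ := h.2 i
    refine ⟨f.symm, fun x => ?_⟩
    have := ih (hf (f.symm x))
    simpa using this

theorem Eqv.trans {r : ℕ} : ∀ {α : Fin m → V} {β : Fin m → W} {γ : Fin m → U}, Eqv G H r α β →
    Eqv H K r β γ → Eqv G K r α γ := by
  induction r with
  | zero =>
    intro α β γ h h' i j
    exact ⟨(h i j).1.trans (h' i j).1, (h i j).2.trans (h' i j).2⟩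
  | succ r ih =>
    intro α β γ h h'
    refine ⟨fun i j => ⟨(h.1 i j).1.trans (h'.1 i j).1, (h.1 i j).2.trans (h'.1 i j).2⟩,
      fun i => ?_⟩
    obtain ⟨f, hf⟩ := h.2 i
    obtain ⟨f', hf'⟩ := h'.2 i
    exact ⟨f.trans f', fun x => ih (hf x) (hf' (f x))⟩

/-- conjunction of a list -/
def conjL {m : ℕ} (b : CFormula m) (l : List (CFormula m)) : CFormula m := l.foldr CFormula.and b

theorem sat_conjL [DecidableEq V] (b : CFormula m) (l : List (CFormula m)) (α : Fin m → V) :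
    CFormula.Sat G (conjL b l) α ↔ CFormula.Sat G b α ∧ ∀ φ ∈ l, CFormula.Sat G φ α := by
  induction l with
  | nil => simp [conjL]
  | cons a l ih =>
    have : conjL b (a :: l) = CFormula.and a (conjL b l) := rfl
    rw [this]
    simp only [CFormula.Sat, ih, List.mem_cons, forall_eq_or_imp]
    tauto

theorem qdepth_conjL (b : CFormula m) (l : List (CFormula m)) (d : ℕ) (hb : b.qdepth ≤ d)
    (hl : ∀ φ ∈ l, φ.qdepth ≤ d) : (conjL b l).qdepth ≤ d := by
  induction l with
  | nil => simpa [conjL] using hb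
  | cons a l ih =>
    have : conjL b (a :: l) = CFormula.and a (conjL b l) := rfl
    rw [this]
    simp only [CFormula.qdepth]
    exact max_le (hl a (by simp)) (ih (fun φ h => hl φ (by simp [h])))

open Classical in
/-- atomic diagram -/
noncomputable def atomF (hm : 0 < m) (G : SimpleGraph V) (α : Fin m → V) : CFormula m :=
  conjL (CFormula.eq ⟨0, hm⟩ ⟨0, hm⟩)
    ((Finset.univ : Finset (Fin m × Fin m)).toList.map fun p =>
      CFormula.and
        (if α p.1 = α p.2 then CFormula.eq p.1 p.2 else CFormula.not (CFormula.eq p.1 p.2))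
        (if G.Adj (α p.1) (α p.2) then CFormula.adj p.1 p.2
          else CFormula.not (CFormula.adj p.1 p.2)))

theorem sat_atomF [DecidableEq W] (hm : 0 < m) (α : Fin m → V) (β : Fin m → W) :
    CFormula.Sat H (atomF hm G α) β ↔ Eqv G H 0 α β := by
  rw [atomF, sat_conjL]
  simp only [CFormula.Sat, true_and, List.mem_map, Finset.mem_toList, Finset.mem_univ,
    Prod.exists, forall_exists_index, Eqv]
  constructor
  · intro h i j
    have := h _ i j rfl
    simp only [CFormula.Sat] at this
    obtain ⟨h1, h2⟩ := this
    split_ifs at h1 h2 <;> simp_all [CFormula.Sat]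
  · rintro h φ i j rfl
    obtain ⟨h1, h2⟩ := h i j
    simp only [CFormula.Sat]
    constructor
    · split_ifs <;> simp_all [CFormula.Sat]
    · split_ifs <;> simp_all [CFormula.Sat]

theorem qdepth_atomF (hm : 0 < m) (α : Fin m → V) : (atomF hm G α).qdepth ≤ 0 := by
  refine qdepth_conjL _ _ _ (by simp [CFormula.qdepth]) ?_
  intro φ hφ
  simp only [List.mem_map, Finset.mem_toList, Finset.mem_univ, true_and] at hφ
  obtain ⟨p, rfl⟩ := hφ
  split_ifs <;> simp [CFormula.qdepth]

/-- Hintikka formulas -/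
noncomputable def hintik (hm : 0 < m) [Fintype V] [DecidableEq V] (G : SimpleGraph V) :
    ℕ → (Fin m → V) → CFormula m
  | 0, α => atomF hm G α
  | r + 1, α => CFormula.and (atomF hm G α) <|
      conjL (CFormula.not (CFormula.count (Fintype.card V + 1) ⟨0, hm⟩
        (CFormula.eq ⟨0, hm⟩ ⟨0, hm⟩)))
      ((Finset.univ : Finset (Fin m × V)).toList.map fun p =>
        CFormula.count
          (Nat.card {y : V // CFormula.Sat G (hintik hm G r (Function.update α p.1 p.2))
            (Function.update α p.1 y)}) p.1 (hintik hm G r (Function.update α p.1 p.2)))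

theorem qdepth_hint (hm : 0 < m) [Fintype V] [DecidableEq V] (r : ℕ) :
    ∀ α : Fin m → V, (hintik hm G r α).qdepth ≤ r := by
  induction r with
  | zero => intro α; exact qdepth_atomF hm α
  | succ r ih =>
    intro α
    simp only [hintik, CFormula.qdepth]
    refine max_le ((qdepth_atomF hm α).trans (by omega)) ?_
    refine qdepth_conjL _ _ _ (by simp [CFormula.qdepth]) ?_
    intro φ hφ
    simp only [List.mem_map, Finset.mem_toList, Finset.mem_univ, true_and] at hφ
    obtain ⟨p, rfl⟩ := hφ
    simp only [CFormula.qdepth]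
    have := ih (Function.update α p.1 p.2)
    omega

theorem exists_equiv_of_classes [Fintype V] [Fintype W] (hc : Fintype.card W ≤ Fintype.card V)
    (R : V → V → Prop) (T : V → W → Prop) (hR : Equivalence R)
    (hRT : ∀ x y z, R x y → T y z → T x z) (hTT : ∀ x y z, T x z → T y z → R x y)
    (hcard : ∀ x, Nat.card {y // R x y} ≤ Nat.card {z // T x z}) :
    ∃ h : V ≃ W, ∀ x, T x (h x) := by
  classical
  let S : Setoid V := ⟨R, hR⟩
  have emb : ∀ x, Nonempty ({y // R x y} ↪ {z // T x z}) := by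
    intro x
    have := hcard x
    rw [Nat.card_eq_fintype_card, Nat.card_eq_fintype_card] at this
    exact Function.Embedding.nonempty_of_card_le this
  let e := fun x => (emb x).some
  let rep : V → V := fun x => (Quotient.mk S x).out
  have hrep : ∀ x, R (rep x) x := fun x => Quotient.exact (Quotient.out_eq (Quotient.mk S x))
  have hrep' : ∀ x y, R x y → rep x = rep y := by
    intro x y h
    have : Quotient.mk S x = Quotient.mk S y := Quotient.sound h
    simp only [rep, this]
  let f : V → W := fun x => (e (rep x) ⟨x, hrep x⟩).1
  have hf0 : ∀ x, T (rep x) (f x) := fun x => (e (rep x) ⟨x, hrep x⟩).2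
  have hf : ∀ x, T x (f x) := fun x => hRT _ _ _ (hR.symm (hrep x)) (hf0 x)
  have key : ∀ (a b x y : V) (hx : R a x) (hy : R b y), a = b →
      (e a ⟨x, hx⟩).1 = (e b ⟨y, hy⟩).1 → x = y := by
    intro a b x y hx hy hab h
    subst hab
    have := (e a).injective (Subtype.ext h)
    simpa using this
  have inj : Function.Injective f := by
    intro x y hxy
    have h1 : R x y := hTT _ _ _ (hf x) (by rw [hxy]; exact hf y)
    exact key _ _ _ _ _ _ (hrep' _ _ h1) hxy
  have bij : Function.Bijective f := by
    rw [Fintype.bijective_iff_injective_and_card]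
    exact ⟨inj, le_antisymm (Fintype.card_le_of_injective f inj) hc⟩
  exact ⟨Equiv.ofBijective f bij, hf⟩

theorem sat_hint (hm : 0 < m) [Fintype V] [DecidableEq V] (r : ℕ) :
    ∀ {W : Type} [Fintype W] [DecidableEq W] (H : SimpleGraph W) (α : Fin m → V) (β : Fin m → W),
      CFormula.Sat H (hintik hm G r α) β ↔ Eqv G H r α β := by
  induction r with
  | zero => intro W _ _ H α β; exact sat_atomF hm α β
  | succ r ih =>
    intro W _ _ H α β
    simp only [hintik, CFormula.Sat, sat_conjL, sat_atomF, List.mem_map, Finset.mem_toList,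
      Finset.mem_univ, true_and, Prod.exists, forall_exists_index]
    have e1 : Nat.card {_x : W // True} = Fintype.card W := by
      simp
    constructor
    · rintro ⟨h0, hc, hall⟩
      rw [e1] at hc
      refine ⟨h0, fun i => ?_⟩
      refine exists_equiv_of_classes (by omega)
        (fun x y => Eqv G G r (Function.update α i x) (Function.update α i y))
        (fun x z => Eqv G H r (Function.update α i x) (Function.update β i z))
        ⟨fun x => Eqv.rfl_self _, fun h => h.symm, fun h h' => h.trans h'⟩
        (fun x y z h h' => h.trans h') (fun x y z h h' => h.trans h'.symm) ?_
      intro x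
      have := hall _ i x rfl
      simp only [CFormula.Sat] at this
      simpa only [ih] using this
    · rintro ⟨h0, hall⟩
      refine ⟨h0, ?_, ?_⟩
      · rw [e1]
        obtain ⟨h, -⟩ := hall ⟨0, hm⟩
        rw [Fintype.card_congr h]; omega
      · rintro φ i x rfl
        obtain ⟨h, hh⟩ := hall i
        simp only [CFormula.Sat, ih]
        refine Nat.card_le_card_of_injective
          (fun y => ⟨h y.1, y.2.trans (hh y.1)⟩) ?_
        intro y y' hy
        simpa [Subtype.ext_iff] using hy

/-- existential closure -/
def exL {m : ℕ} (l : List (Fin m)) (φ : CFormula m) : CFormula m := l.foldr CFormula.ex φ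

theorem qdepth_exL (l : List (Fin m)) (φ : CFormula m) :
    (exL l φ).qdepth = l.length + φ.qdepth := by
  induction l with
  | nil => simp [exL]
  | cons a l ih =>
    have : exL (a :: l) φ = CFormula.ex a (exL l φ) := rfl
    rw [this]; simp only [CFormula.qdepth, ih, List.length_cons]; omega

theorem freeVars_exL (l : List (Fin m)) (φ : CFormula m) (i : Fin m)
    (h : i ∈ (exL l φ).freeVars) : i ∉ l := by
  induction l with
  | nil => simp
  | cons a l ih =>
    have : exL (a :: l) φ = CFormula.ex a (exL l φ) := rfl
    rw [this] at h
    simp only [CFormula.freeVars, Finset.mem_erase] at h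
    simp only [List.mem_cons, not_or]
    exact ⟨h.1, ih h.2⟩

theorem sat_exL_of [DecidableEq V] (l : List (Fin m)) (φ : CFormula m) : ∀ (α : Fin m → V),
    CFormula.Sat G (exL l φ) α → ∃ β, CFormula.Sat G φ β := by
  induction l with
  | nil => intro α h; exact ⟨α, h⟩
  | cons a l ih =>
    intro α h
    obtain ⟨x, hx⟩ := h
    exact ih _ hx

theorem sat_exL_to [DecidableEq V] (l : List (Fin m)) (φ : CFormula m) (γ : Fin m → V)
    (hγ : CFormula.Sat G φ γ) : ∀ (α : Fin m → V), (∀ i, i ∉ l → α i = γ i) →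
    CFormula.Sat G (exL l φ) α := by
  induction l with
  | nil =>
    intro α h
    have : α = γ := funext fun i => h i (by simp)
    subst this; exact hγ
  | cons a l ih =>
    intro α h
    refine ⟨γ a, ih _ ?_⟩
    intro i hi
    by_cases hia : i = a
    · subst hia; simp
    · rw [Function.update_of_ne hia]; exact h i (by simp [hia, hi])

theorem exists_sentence (hm : 0 < m) [Fintype V] [DecidableEq V] (G : SimpleGraph V) (γ : Fin m → V)
    (r : ℕ) :
    ∃ φ : CFormula m, φ.freeVars = ∅ ∧ φ.qdepth ≤ m + r ∧
      (∀ α : Fin m → V, CFormula.Sat G φ α) ∧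
      (∀ (W : Type) [Fintype W] [DecidableEq W] (H : SimpleGraph W) (α : Fin m → W),
        CFormula.Sat H φ α → ∃ β, Eqv G H r γ β) := by
  refine ⟨exL (List.finRange m) (hintik hm G r γ), ?_, ?_, ?_, ?_⟩
  · ext i
    simp only [Finset.notMem_empty, iff_false]
    intro h
    exact freeVars_exL _ _ _ h (List.mem_finRange i)
  · rw [qdepth_exL, List.length_finRange]
    have := qdepth_hint (G := G) hm r γ
    omega
  · intro α
    refine sat_exL_to _ _ γ ((sat_hint hm r G γ γ).2 (Eqv.rfl_self _)) α ?_
    intro i hi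
    exact absurd (List.mem_finRange i) hi
  · intro W _ _ H α h
    obtain ⟨β, hβ⟩ := sat_exL_of _ _ α h
    exact ⟨β, (sat_hint hm r H γ β).1 hβ⟩

end PartA

section PartB

open Classical in
/-- adjacency over `F₂` -/
noncomputable def aF {V : Type} (G : SimpleGraph V) (x y : V) : ZMod 2 := if G.Adj x y then 1 else 0

theorem aF_symm {V : Type} (G : SimpleGraph V) (x y : V) : aF G x y = aF G y x := by
  have := G.adj_comm x y
  unfold aF
  split_ifs <;> tauto

theorem aF_eq_iff {V W : Type} {G : SimpleGraph V} {H : SimpleGraph W} {x y : V} {x' y' : W} :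
    aF G x y = aF H x' y' ↔ (G.Adj x y ↔ H.Adj x' y') := by
  simp only [aF]
  split_ifs <;> simp_all

/-- coefficient matrices -/
abbrev Coef (m : ℕ) := Fin m → Fin m → ZMod 2

/-- predicted adjacency -/
noncomputable def PP {m : ℕ} {V : Type} (G : SimpleGraph V) (α : Fin m → V) (N : Coef m)
    (x y : V) : ZMod 2 := ∑ i, ∑ j, aF G x (α i) * N i j * aF G (α j) y

/-- the digraph of implications -/
def Arc {m : ℕ} {V : Type} (G : SimpleGraph V) (α : Fin m → V) (N : Coef m) (x y : V) : Prop :=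
  aF G x y ≠ PP G α N x y

/-- reachability -/
def Reach {m : ℕ} {V : Type} (G : SimpleGraph V) (α : Fin m → V) (N : Coef m) : V → V → Prop :=
  Relation.ReflTransGen (Arc G α N)

/-- reach number -/
noncomputable def rn {m : ℕ} {V : Type} (G : SimpleGraph V) (α : Fin m → V) (N : Coef m)
    (x : V) : ℕ := Nat.card {w : V // Reach G α N x w}

/-- support of a coefficient matrix -/
def Supp {m : ℕ} (N : Coef m) (I : Finset (Fin m)) : Prop := ∀ i j, N i j ≠ 0 → i ∈ I ∧ j ∈ I

/-- strongly connected w.r.t. all the coefficient matrices in the list -/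
def SCL {m : ℕ} {V : Type} (G : SimpleGraph V) (α : Fin m → V) (Γ : List (Coef m)) (x y : V) :
    Prop := ∀ N ∈ Γ, Reach G α N x y ∧ Reach G α N y x

variable {m : ℕ} {V W : Type} {G : SimpleGraph V} {H : SimpleGraph W}

theorem Supp.mono {N : Coef m} {I J : Finset (Fin m)} (h : Supp N I) (hIJ : I ⊆ J) : Supp N J :=
  fun i j hij => ⟨hIJ (h i j hij).1, hIJ (h i j hij).2⟩

theorem SCL.refl (α : Fin m → V) (Γ : List (Coef m)) (x : V) : SCL G α Γ x x :=
  fun _ _ => ⟨Relation.ReflTransGen.refl, Relation.ReflTransGen.refl⟩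

theorem SCL.symm {α : Fin m → V} {Γ : List (Coef m)} {x y : V} (h : SCL G α Γ x y) :
    SCL G α Γ y x := fun N hN => ⟨(h N hN).2, (h N hN).1⟩

theorem SCL.trans {α : Fin m → V} {Γ : List (Coef m)} {x y z : V} (h : SCL G α Γ x y)
    (h' : SCL G α Γ y z) : SCL G α Γ x z :=
  fun N hN => ⟨(h N hN).1.trans (h' N hN).1, (h' N hN).2.trans (h N hN).2⟩

/-- `PP` only depends on the types. -/
theorem PP_congr {N : Coef m} {I : Finset (Fin m)} (hN : Supp N I) {α : Fin m → V}
    {β : Fin m → W} {x y : V} {x' y' : W}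
    (hx : ∀ i ∈ I, G.Adj x (α i) ↔ H.Adj x' (β i)) (hy : ∀ i ∈ I, G.Adj y (α i) ↔ H.Adj y' (β i)) :
    PP G α N x y = PP H β N x' y' := by
  unfold PP
  refine Finset.sum_congr rfl fun i _ => Finset.sum_congr rfl fun j _ => ?_
  by_cases h : N i j = 0
  · simp [h]
  · obtain ⟨hi, hj⟩ := hN i j h
    rw [aF_eq_iff.2 (hx i hi), aF_symm G (α j), aF_symm H (β j),
      aF_eq_iff.2 (hy j hj)]

theorem Arc_congr {N : Coef m} {I : Finset (Fin m)} (hN : Supp N I) {α : Fin m → V}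
    {β : Fin m → W} {x y : V} {x' y' : W}
    (hx : ∀ i ∈ I, G.Adj x (α i) ↔ H.Adj x' (β i)) (hy : ∀ i ∈ I, G.Adj y (α i) ↔ H.Adj y' (β i))
    (hxy : G.Adj x y ↔ H.Adj x' y') :
    Arc G α N x y ↔ Arc H β N x' y' := by
  unfold Arc
  rw [PP_congr hN hx hy, aF_eq_iff.2 hxy]

theorem Reach_agree {N : Coef m} {I : Finset (Fin m)} (hN : Supp N I) {α β : Fin m → V}
    (h : ∀ i ∈ I, α i = β i) : Reach G α N = Reach G β N := by
  have : Arc G α N = Arc G β N := by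
    funext x y
    exact propext (Arc_congr hN (fun i hi => by rw [h i hi]) (fun i hi => by rw [h i hi]) Iff.rfl)
  unfold Reach
  rw [this]

theorem rn_agree {N : Coef m} {I : Finset (Fin m)} (hN : Supp N I) {α β : Fin m → V}
    (h : ∀ i ∈ I, α i = β i) (x : V) : rn G α N x = rn G β N x := by
  unfold rn; rw [Reach_agree hN h]

theorem SCL_agree {Γ : List (Coef m)} {I : Finset (Fin m)} (hN : ∀ N ∈ Γ, Supp N I)
    {α β : Fin m → V} (h : ∀ i ∈ I, α i = β i) : SCL G α Γ = SCL G β Γ := by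
  funext x y
  apply propext
  unfold SCL
  refine forall_congr' fun N => forall_congr' fun hN' => ?_
  rw [Reach_agree (hN N hN') h]

theorem Fits_closed {N : Coef m} {α : Fin m → V} {X : Finset V}
    (hf : ∀ x ∈ X, ∀ y, y ∉ X → aF G x y = PP G α N x y) {x y : V} (hx : x ∈ X)
    (h : Reach G α N x y) : y ∈ X := by
  induction h with
  | refl => exact hx
  | tail _ h ih =>
    by_contra hc
    exact h (hf _ ih _ hc)

theorem rn_lt [Fintype V] {N : Coef m} {α : Fin m → V} {x y : V} (h : Reach G α N x y)
    (h' : ¬ Reach G α N y x) : rn G α N y < rn G α N x := by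
  unfold rn
  have : {w | Reach G α N y w} ⊂ {w | Reach G α N x w} := by
    refine ⟨fun w hw => h.trans hw, fun hc => h' (hc (Relation.ReflTransGen.refl : Reach G α N x x))⟩
  exact Set.ncard_lt_ncard this (Set.toFinite _)

theorem zmod2_eq {a b c : ZMod 2} (h : a ≠ b) (h' : a ≠ c) : b = c := by
  revert a b c; decide

/-- Adjacency across different classes is determined by colours. -/
theorem interclass [Fintype V] [Fintype W] {N : Coef m} {I : Finset (Fin m)} (hN : Supp N I)
    {α : Fin m → V} {β : Fin m → W} {x y : V} {x' y' : W}
    (hx : ∀ i ∈ I, G.Adj x (α i) ↔ H.Adj x' (β i)) (hy : ∀ i ∈ I, G.Adj y (α i) ↔ H.Adj y' (β i))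
    (rx : rn G α N x = rn H β N x') (ry : rn G α N y = rn H β N y')
    (h : ¬ SCL G α [N] x y) (h' : ¬ SCL H β [N] x' y') :
    G.Adj x y ↔ H.Adj x' y' := by
  rw [← aF_eq_iff]
  simp only [SCL, List.mem_singleton, forall_eq] at h h'
  have p1 := PP_congr (G := G) (H := H) hN hx hy
  have p2 := PP_congr (G := G) (H := H) hN hy hx
  by_contra hne
  have a1 : Arc G α N x y → Reach G α N x y := fun h => Relation.ReflTransGen.single h
  have a2 : Arc G α N y x → Reach G α N y x := fun h => Relation.ReflTransGen.single h
  have b1 : Arc H β N x' y' → Reach H β N x' y' := fun h => Relation.ReflTransGen.single h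
  have b2 : Arc H β N y' x' → Reach H β N y' x' := fun h => Relation.ReflTransGen.single h
  have l1 := fun u v => rn_lt (G := G) (N := N) (α := α) (x := x) (y := y) u v
  have l2 := fun u v => rn_lt (G := G) (N := N) (α := α) (x := y) (y := x) u v
  have l3 := fun u v => rn_lt (G := H) (N := N) (α := β) (x := x') (y := y') u v
  have l4 := fun u v => rn_lt (G := H) (N := N) (α := β) (x := y') (y := x') u v
  unfold Arc at a1 a2 b1 b2
  rw [← p1] at b1
  rw [← p2, aF_symm H] at b2
  rw [aF_symm G] at a2
  generalize aF G x y = a at *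
  generalize aF H x' y' = a' at *
  generalize PP G α N x y = p at *
  generalize PP G α N y x = q at *
  by_cases c1 : a = p
  · have c2 : a' ≠ p := fun h => hne (c1.trans h.symm)
    by_cases c3 : a' = q
    · have c4 : a ≠ q := fun h => hne (h.trans c3.symm)
      have e1 := b1 c2
      have e2 := a2 c4
      have := l2 e2 (fun hh => h ⟨hh, e2⟩)
      have := l3 e1 (fun hh => h' ⟨e1, hh⟩)
      omega
    · exact h' ⟨b1 c2, b2 c3⟩
  · by_cases c3 : a = q
    · have c4 : a' ≠ q := fun h => hne (c3.trans h.symm)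
      have e1 := a1 c1
      have e2 := b2 c4
      have := l1 e1 (fun hh => h ⟨e1, hh⟩)
      have := l4 e2 (fun hh => h' ⟨hh, e2⟩)
      omega
    · exact h ⟨a1 c1, a2 c3⟩

/-- bounded reachability with doubling -/
def RD {V : Type} (r : V → V → Prop) : ℕ → V → V → Prop
  | 0, x, y => x = y ∨ r x y
  | t + 1, x, y => ∃ z, RD r t x z ∧ RD r t z y

/-- bounded reachability -/
def RL {V : Type} (r : V → V → Prop) : ℕ → V → V → Prop
  | 0, x, y => x = y
  | t + 1, x, y => RL r t x y ∨ ∃ z, RL r t x z ∧ r z y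

theorem RL_refl (r : V → V → Prop) (t : ℕ) (x : V) : RL r t x x := by
  induction t with
  | zero => rfl
  | succ t ih => exact Or.inl ih

theorem RL_mono (r : V → V → Prop) {s t : ℕ} (h : s ≤ t) {x y : V} (hs : RL r s x y) :
    RL r t x y := by
  induction t, h using Nat.le_induction with
  | base => exact hs
  | succ t _ ih => exact Or.inl ih

theorem RL_split (r : V → V → Prop) (s t : ℕ) : ∀ {x y : V}, RL r (s + t) x y →
    ∃ z, RL r s x z ∧ RL r t z y := by
  induction t with
  | zero => intro x y h; exact ⟨y, h, rfl⟩
  | succ t ih =>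
    intro x y h
    rcases h with h | ⟨w, h, hw⟩
    · obtain ⟨z, h1, h2⟩ := ih h
      exact ⟨z, h1, Or.inl h2⟩
    · obtain ⟨z, h1, h2⟩ := ih h
      exact ⟨z, h1, Or.inr ⟨w, h2, hw⟩⟩

theorem RL_RD (r : V → V → Prop) (t : ℕ) : ∀ {x y : V}, RL r (2 ^ t) x y → RD r t x y := by
  induction t with
  | zero =>
    intro x y h
    rcases h with h | ⟨w, h, hw⟩
    · exact Or.inl h
    · have : x = w := h
      subst this; exact Or.inr hw
  | succ t ih =>
    intro x y h
    rw [pow_succ, mul_two] at h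
    obtain ⟨z, h1, h2⟩ := RL_split r _ _ h
    exact ⟨z, ih h1, ih h2⟩

theorem RD_RTG (r : V → V → Prop) (t : ℕ) : ∀ {x y : V}, RD r t x y →
    Relation.ReflTransGen r x y := by
  induction t with
  | zero =>
    rintro x y (h | h)
    · subst h; exact .refl
    · exact .single h
  | succ t ih =>
    rintro x y ⟨z, h1, h2⟩
    exact (ih h1).trans (ih h2)

theorem RTG_RL [Fintype V] (r : V → V → Prop) {x y : V} (h : Relation.ReflTransGen r x y) :
    RL r (Fintype.card V) x y := by
  classical
  let S : ℕ → Finset V := fun t => Finset.univ.filter (fun y => RL r t x y)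
  have hmono : ∀ t, S t ⊆ S (t + 1) := by
    intro t w hw
    simp only [S, Finset.mem_filter, Finset.mem_univ, true_and] at hw ⊢
    exact Or.inl hw
  -- some step is stationary
  have hex : ∃ t ≤ Fintype.card V, S t = S (t + 1) := by
    by_contra hc
    push Not at hc
    have : ∀ t ≤ Fintype.card V + 1, t ≤ (S t).card := by
      intro t
      induction t with
      | zero => intro _; omega
      | succ t ih =>
        intro ht
        have h1 := ih (by omega)
        have h2 := Finset.card_lt_card ((hmono t).ssubset_of_ne (hc t (by omega)))
        omega
    have h1 := this _ le_rfl
    have h2 := Finset.card_le_univ (S (Fintype.card V + 1))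
    omega
  obtain ⟨t, ht, hst⟩ := hex
  refine RL_mono r ht ?_
  have : ∀ y, Relation.ReflTransGen r x y → y ∈ S t := by
    intro y hy
    induction hy with
    | refl => simp only [S, Finset.mem_filter, Finset.mem_univ, true_and]; exact RL_refl r t x
    | tail _ hbc ih =>
      rw [hst]
      simp only [S, Finset.mem_filter, Finset.mem_univ, true_and] at ih ⊢
      exact Or.inr ⟨_, ih, hbc⟩
  simpa [S] using this y h

theorem RTG_RD [Fintype V] (r : V → V → Prop) {t : ℕ} (ht : Fintype.card V ≤ 2 ^ t) {x y : V} :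
    Relation.ReflTransGen r x y ↔ RD r t x y :=
  ⟨fun h => RL_RD r t (RL_mono r ht (RTG_RL r h)), RD_RTG r t⟩

theorem RD_test {N : Coef m} {J : Finset (Fin m)} (hN : Supp N J) (t : ℕ) :
    ∀ {α : Fin m → V} {β : Fin m → W} {i j l : Fin m}, i ∉ J → j ∉ J → l ∉ J → i ≠ j → i ≠ l →
      j ≠ l → Eqv G H t α β → RD (Arc G α N) t (α i) (α j) → RD (Arc H β N) t (β i) (β j) := by
  induction t with
  | zero =>
    intro α β i j l hi hj hl hij hil hjl h hr
    rcases hr with hr | hr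
    · exact Or.inl ((h.atom i j).1.1 hr)
    · exact Or.inr ((Arc_congr hN (fun a _ => (h.atom i a).2) (fun a _ => (h.atom j a).2)
        (h.atom i j).2).1 hr)
  | succ t ih =>
    intro α β i j l hi hj hl hij hil hjl h hr
    obtain ⟨z, h1, h2⟩ := hr
    obtain ⟨f, hf⟩ := h.2 l
    have hz := hf z
    have eα : Arc G α N = Arc G (Function.update α l z) N := by
      funext x y
      refine propext (Arc_congr hN ?_ ?_ Iff.rfl) <;>
      · intro a ha
        rw [Function.update_of_ne]; rintro rfl; exact hl ha
    have eβ : Arc H β N = Arc H (Function.update β l (f z)) N := by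
      funext x y
      refine propext (Arc_congr hN ?_ ?_ Iff.rfl) <;>
      · intro a ha
        rw [Function.update_of_ne]; rintro rfl; exact hl ha
    refine ⟨f z, ?_, ?_⟩
    · have := ih hi hl hj hil hij hjl.symm hz
      rw [← eα, ← eβ] at this
      simp only [Function.update_self, Function.update_of_ne hil] at this
      exact this h1
    · have := ih hl hj hi hjl.symm hil.symm hij.symm hz
      rw [← eα, ← eβ] at this
      simp only [Function.update_self, Function.update_of_ne hjl] at this
      exact this h2

theorem reach_test [Fintype V] [Fintype W] {N : Coef m} {J : Finset (Fin m)} (hN : Supp N J)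
    {L r : ℕ} (hV : Fintype.card V ≤ 2 ^ L) (hW : Fintype.card W ≤ 2 ^ L) (hr : L ≤ r)
    {α : Fin m → V} {β : Fin m → W} {i j l : Fin m} (hi : i ∉ J) (hj : j ∉ J) (hl : l ∉ J)
    (hij : i ≠ j) (hil : i ≠ l) (hjl : j ≠ l) (h : Eqv G H r α β) :
    Reach G α N (α i) (α j) ↔ Reach H β N (β i) (β j) := by
  unfold Reach
  rw [RTG_RD _ hV, RTG_RD _ hW]
  have h' := h.mono hr
  exact ⟨RD_test hN L hi hj hl hij hil hjl h', RD_test hN L hi hj hl hij hil hjl h'.symm⟩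

theorem scl_test [Fintype V] [Fintype W] {Γ : List (Coef m)} {J : Finset (Fin m)}
    (hN : ∀ N ∈ Γ, Supp N J)
    {L r : ℕ} (hV : Fintype.card V ≤ 2 ^ L) (hW : Fintype.card W ≤ 2 ^ L) (hr : L ≤ r)
    {α : Fin m → V} {β : Fin m → W} {i j l : Fin m} (hi : i ∉ J) (hj : j ∉ J) (hl : l ∉ J)
    (hij : i ≠ j) (hil : i ≠ l) (hjl : j ≠ l) (h : Eqv G H r α β) :
    SCL G α Γ (α i) (α j) ↔ SCL H β Γ (β i) (β j) := by
  unfold SCL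
  refine forall_congr' fun N => forall_congr' fun hN' => ?_
  rw [reach_test (hN N hN') hV hW hr hi hj hl hij hil hjl h,
    reach_test (hN N hN') hV hW hr hj hi hl hij.symm hjl hil h]

theorem agree_update {J : Finset (Fin m)} (α : Fin m → V) {l : Fin m} (hl : l ∉ J) (x : V) :
    ∀ i ∈ J, Function.update α l x i = α i := by
  intro i hi
  rw [Function.update_of_ne]; rintro rfl; exact hl hi

theorem rn_test [Fintype V] [Fintype W] {N : Coef m} {J : Finset (Fin m)} (hN : Supp N J)
    {L r : ℕ} (hV : Fintype.card V ≤ 2 ^ L) (hW : Fintype.card W ≤ 2 ^ L) (hr : L + 1 ≤ r)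
    {α : Fin m → V} {β : Fin m → W} {i j l : Fin m} (hi : i ∉ J) (hj : j ∉ J) (hl : l ∉ J)
    (hij : i ≠ j) (hil : i ≠ l) (hjl : j ≠ l) (h : Eqv G H r α β) :
    rn G α N (α i) = rn H β N (β i) := by
  have h1 : Eqv G H (L + 1) α β := h.mono hr
  obtain ⟨f, hf⟩ := h1.2 j
  unfold rn
  refine Nat.card_congr (f.subtypeEquiv fun w => ?_)
  have := reach_test hN hV hW le_rfl hi hj hl hij hil hjl (hf w)
  rw [Reach_agree hN (agree_update α hj w), Reach_agree hN (agree_update β hj (f w))] at this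
  simpa only [Function.update_self, Function.update_of_ne hij] using this

end PartB

section PartC

theorem quot_card {A : Type} [Fintype A] (s : Setoid A) (p : Quotient s → Prop) :
    (Nat.card {q // p q} : ℚ) =
      ∑ᶠ u : {a : A // p (Quotient.mk s a)}, (1 / (Nat.card {x // s x u.1} : ℚ)) := by
  classical
  rw [finsum_eq_sum_of_fintype]
  have e1 : ∑ u : {a : A // p (Quotient.mk s a)}, (1 / (Nat.card {x // s x u.1} : ℚ))
      = ∑ q : {q // p q}, ∑ u : {u : {a : A // p (Quotient.mk s a)} //
          (⟨Quotient.mk s u.1, u.2⟩ : {q // p q}) = q}, (1 / (Nat.card {x // s x u.1.1} : ℚ)) := by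
    rw [← Fintype.sum_sigma']
    exact (Fintype.sum_equiv (Equiv.sigmaFiberEquiv
      (fun u : {a : A // p (Quotient.mk s a)} => (⟨Quotient.mk s u.1, u.2⟩ : {q // p q}))) _ _
      (fun _ => rfl)).symm
  rw [e1]
  have e2 : ∀ q : {q // p q}, ∑ u : {u : {a : A // p (Quotient.mk s a)} //
          (⟨Quotient.mk s u.1, u.2⟩ : {q // p q}) = q}, (1 / (Nat.card {x // s x u.1.1} : ℚ)) = 1 := by
    rintro ⟨q, hq⟩
    induction q using Quotient.inductionOn with
    | h a =>
      have hc : ∀ u : {u : {a : A // p (Quotient.mk s a)} //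
          (⟨Quotient.mk s u.1, u.2⟩ : {q // p q}) = ⟨Quotient.mk s a, hq⟩},
          (1 / (Nat.card {x // s x u.1.1} : ℚ)) = 1 / (Nat.card {x // s x a} : ℚ) := by
        rintro ⟨⟨u, hu⟩, hu'⟩
        have hua : s u a := Quotient.exact (congrArg Subtype.val hu')
        have : Nat.card {x // s x u} = Nat.card {x // s x a} :=
          Nat.card_congr (Equiv.subtypeEquivRight fun x =>
            ⟨fun h => s.trans h hua, fun h => s.trans h (s.symm hua)⟩)
        simp only [this]
      rw [Finset.sum_congr rfl (fun u _ => hc u), Finset.sum_const, Finset.card_univ,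
        ← Nat.card_eq_fintype_card]
      have hcard : Nat.card {u : {a : A // p (Quotient.mk s a)} //
          (⟨Quotient.mk s u.1, u.2⟩ : {q // p q}) = ⟨Quotient.mk s a, hq⟩} =
          Nat.card {x // s x a} := by
        refine Nat.card_congr ⟨fun u => ⟨u.1.1, Quotient.exact (congrArg Subtype.val u.2)⟩,
          fun x => ⟨⟨x.1, by rw [Quotient.sound x.2]; exact hq⟩,
            Subtype.ext (Quotient.sound x.2)⟩, fun u => rfl, fun u => rfl⟩
      rw [hcard]
      have : 0 < Nat.card {x // s x a} := by
        haveI : Nonempty {x // s x a} := ⟨⟨a, s.refl a⟩⟩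
        exact Nat.card_pos
      have h0 : (Nat.card {x // s x a} : ℚ) ≠ 0 := by positivity
      rw [nsmul_eq_mul]
      field_simp
  rw [Finset.sum_congr rfl (fun q _ => e2 q)]
  simp

theorem quot_card_eq {A B : Type} [Fintype A] [Fintype B] (s : Setoid A) (s' : Setoid B)
    (h : A ≃ B) (hs : ∀ a, Nat.card {x // s x a} = Nat.card {y // s' y (h a)})
    (p : Quotient s → Prop) (p' : Quotient s' → Prop)
    (hp : ∀ a, p (Quotient.mk s a) ↔ p' (Quotient.mk s' (h a))) :
    Nat.card {q // p q} = Nat.card {q // p' q} := by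
  have h1 := quot_card s p
  have h2 := quot_card s' p'
  have : (Nat.card {q // p q} : ℚ) = (Nat.card {q // p' q} : ℚ) := by
    rw [h1, h2]
    refine finsum_eq_of_bijective (h.subtypeEquiv hp) (Equiv.bijective _) ?_
    intro u
    rw [hs u.1]; rfl
  exact_mod_cast this

theorem exists_quot_equiv {A B : Type} [Fintype A] [Fintype B] (s : Setoid A) (s' : Setoid B)
    (h : A ≃ B) (hs : ∀ a, Nat.card {x // s x a} = Nat.card {y // s' y (h a)})
    (T : Quotient s → Quotient s' → Prop)
    (hT : ∀ a, T (Quotient.mk s a) (Quotient.mk s' (h a)))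
    (zig : ∀ q₁ q q' q'', T q₁ q' → T q q' → T q q'' → T q₁ q'') :
    ∃ π : Quotient s ≃ Quotient s', ∀ q, T q (π q) := by
  classical
  have hT' : ∀ q, ∃ q', T q q' := fun q => Quotient.inductionOn q fun a => ⟨_, hT a⟩
  refine exists_equiv_of_classes ?_ (fun q₁ q₂ => ∃ q', T q₁ q' ∧ T q₂ q') T ⟨?_, ?_, ?_⟩ ?_ ?_ ?_
  · have := quot_card_eq s s' h hs (fun _ => True) (fun _ => True) (fun _ => Iff.rfl)
    simp only [Nat.card_eq_fintype_card] at this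
    rw [Fintype.card_congr (Equiv.subtypeUnivEquiv (fun _ => trivial)),
      Fintype.card_congr (Equiv.subtypeUnivEquiv (fun _ => trivial))] at this
    exact this.ge
  · intro q
    obtain ⟨q', h'⟩ := hT' q
    exact ⟨q', h', h'⟩
  · rintro q₁ q₂ ⟨q', h1, h2⟩
    exact ⟨q', h2, h1⟩
  · rintro q₁ q₂ q₃ ⟨q', h1, h2⟩ ⟨q'', h3, h4⟩
    exact ⟨q'', zig _ _ _ _ h1 h2 h3, h4⟩
  · rintro q₁ q₂ z ⟨q', h1, h2⟩ h3
    exact zig _ _ _ _ h1 h2 h3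
  · intro q₁ q₂ z h1 h2
    exact ⟨z, h1, h2⟩
  · intro q
    refine (quot_card_eq s s' h hs _ _ ?_).le
    intro a
    constructor
    · rintro ⟨q', h1, h2⟩
      exact zig _ _ _ _ h1 h2 (hT a)
    · intro h1
      exact ⟨_, h1, hT a⟩

theorem glue {A B K : Type} [Fintype A] [Fintype B] (ra : A → A → Prop) (rb : B → B → Prop)
    (κ : A → K) (κ' : B → K) (s : Setoid A) (s' : Setoid B) (h : A ≃ B)
    (hloc : ∀ a, ∃ e : {x // s x a} ≃ {y // s' y (h a)},
      (∀ x y, ra x.1 y.1 ↔ rb (e x).1 (e y).1) ∧ ∀ x, κ x.1 = κ' (e x).1)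
    (hinter : ∀ x y x' y', ¬ s x y → ¬ s' x' y' → κ x = κ' x' → κ y = κ' y' →
      (ra x y ↔ rb x' y')) :
    ∃ e : A ≃ B, (∀ x y, ra x y ↔ rb (e x) (e y)) ∧ ∀ x, κ x = κ' (e x) := by
  classical
  let T : Quotient s → Quotient s' → Prop := fun q q' =>
    ∃ e : {x // Quotient.mk s x = q} ≃ {y // Quotient.mk s' y = q'},
      (∀ x y, ra x.1 y.1 ↔ rb (e x).1 (e y).1) ∧ ∀ x, κ x.1 = κ' (e x).1
  have eqA : ∀ a x, Quotient.mk s x = Quotient.mk s a ↔ s x a := fun a x => Quotient.eq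
  have eqB : ∀ a x, Quotient.mk s' x = Quotient.mk s' a ↔ s' x a := fun a x => Quotient.eq
  obtain ⟨π, hπ⟩ := exists_quot_equiv s s' h
    (fun a => Nat.card_congr (hloc a).choose) T
    (by
      intro a
      obtain ⟨e, h1, h2⟩ := hloc a
      refine ⟨(Equiv.subtypeEquivRight (eqA a)).trans
        (e.trans (Equiv.subtypeEquivRight (eqB (h a))).symm), ?_, ?_⟩
      · intro x y; exact h1 ⟨x.1, (eqA a x.1).1 x.2⟩ ⟨y.1, (eqA a y.1).1 y.2⟩
      · intro x; exact h2 ⟨x.1, _⟩)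
    (by
      rintro q₁ q q' q'' ⟨e1, h1, k1⟩ ⟨e2, h2, k2⟩ ⟨e3, h3, k3⟩
      refine ⟨e1.trans (e2.symm.trans e3), ?_, ?_⟩
      · intro x y
        have := h2 (e2.symm (e1 x)) (e2.symm (e1 y))
        simp only [Equiv.apply_symm_apply] at this
        simp only [Equiv.trans_apply]
        rw [h1, ← h3, this]
      · intro x
        have := k2 (e2.symm (e1 x))
        simp only [Equiv.apply_symm_apply] at this
        simp only [Equiv.trans_apply]
        rw [k1, ← k3, this])
  choose e he hk using hπ
  let E : A ≃ B := (Equiv.sigmaFiberEquiv (Quotient.mk s)).symm.trans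
    ((Equiv.sigmaCongr π e).trans (Equiv.sigmaFiberEquiv (Quotient.mk s')))
  have hE : ∀ x, E x = (e (Quotient.mk s x) ⟨x, rfl⟩).1 := fun x => rfl
  have hE' : ∀ q x (hx : Quotient.mk s x = q), E x = (e q ⟨x, hx⟩).1 := by
    rintro q x rfl; exact hE x
  have hκ : ∀ x, κ x = κ' (E x) := fun x => hk _ ⟨x, rfl⟩
  refine ⟨E, ?_, hκ⟩
  intro x y
  by_cases hxy : s x y
  · have hq : Quotient.mk s x = Quotient.mk s y := Quotient.sound hxy
    rw [hE' _ x hq, hE' _ y rfl]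
    exact he _ ⟨x, hq⟩ ⟨y, rfl⟩
  · refine hinter _ _ _ _ hxy ?_ (hκ x) (hκ y)
    intro hc
    have h1 : Quotient.mk s' (E x) = π (Quotient.mk s x) := (e (Quotient.mk s x) ⟨x, rfl⟩).2
    have h2 : Quotient.mk s' (E y) = π (Quotient.mk s y) := (e (Quotient.mk s y) ⟨y, rfl⟩).2
    have h3 : Quotient.mk s' (E x) = Quotient.mk s' (E y) := Quotient.sound hc
    rw [h1, h2] at h3
    exact hxy (Quotient.exact (π.injective h3))

theorem first_exit {V : Type} {r : V → V → Prop} {C : Set V} {x w : V} (h : Relation.ReflTransGen r x w) :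
    x ∈ C → (w ∈ C ∧ Relation.ReflTransGen (fun a b => a ∈ C ∧ b ∈ C ∧ r a b) x w) ∨
      ∃ a y, a ∈ C ∧ y ∉ C ∧ Relation.ReflTransGen (fun a b => a ∈ C ∧ b ∈ C ∧ r a b) x a ∧ r a y ∧
        Relation.ReflTransGen r y w := by
  induction h using Relation.ReflTransGen.head_induction_on with
  | refl => intro hw; exact Or.inl ⟨hw, .refl⟩
  | head hxc hcw ih =>
    rename_i x c
    intro hx
    by_cases hc : c ∈ C
    · rcases ih hc with ⟨h1, h2⟩ | ⟨a, y, ha, hy, h1, h2, h3⟩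
      · exact Or.inl ⟨h1, .head ⟨hx, hc, hxc⟩ h2⟩
      · exact Or.inr ⟨a, y, ha, hy, .head ⟨hx, hc, hxc⟩ h1, h2, h3⟩
    · exact Or.inr ⟨x, c, hx, hc, .refl, hxc, hcw⟩

theorem last_exit {V : Type} {r : V → V → Prop} {C : Set V} {y w : V} (h : Relation.ReflTransGen r y w) :
    y ∉ C → w ∈ C → ∃ z b, z ∉ C ∧ b ∈ C ∧ Relation.ReflTransGen r y z ∧ r z b ∧
      Relation.ReflTransGen (fun a b => a ∈ C ∧ b ∈ C ∧ r a b) b w := by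
  induction h with
  | refl => intro h1 h2; exact absurd h2 h1
  | tail hyc hcw ih =>
    rename_i c w
    intro hy hw
    by_cases hc : c ∈ C
    · obtain ⟨z, b, hz, hb, h1, h2, h3⟩ := ih hy hc
      exact ⟨z, b, hz, hb, h1, h2, h3.tail ⟨hc, hw, hcw⟩⟩
    · exact ⟨c, w, hc, hw, hyc, hcw, .refl⟩

theorem drop_reach {V W : Type} {r : V → V → Prop} {r' : W → W → Prop} {C : Set V} {C' : Set W}
    (g : V ≃ W) (hg : ∀ x, x ∈ C ↔ g x ∈ C') (h1 : ∀ x ∈ C, ∀ w, r x w ↔ r' (g x) (g w))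
    (h2 : ∀ y, y ∉ C → ∃ f : V ≃ W, (∀ z, z ∈ C ↔ f z ∈ C') ∧
      (∀ z, Relation.ReflTransGen r y z ↔ Relation.ReflTransGen r' (g y) (f z)) ∧
      (∀ z, Relation.ReflTransGen r z y ↔ Relation.ReflTransGen r' (f z) (g y)) ∧
      ∀ z, z ∉ C → ∀ x ∈ C, (r z x ↔ r' (f z) (g x)) ∧ (r x z ↔ r' (g x) (f z)))
    {x w : V} (hx : x ∈ C) (h : Relation.ReflTransGen r x w) :
    Relation.ReflTransGen r' (g x) (g w) := by
  have hin : ∀ {a b}, Relation.ReflTransGen (fun a b => a ∈ C ∧ b ∈ C ∧ r a b) a b →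
      Relation.ReflTransGen r' (g a) (g b) := by
    intro a b hab
    exact hab.lift g (fun a b hab => (h1 a hab.1 b).1 hab.2.2)
  rcases first_exit h hx with ⟨_, h3⟩ | ⟨a, y, ha, hy, h3, h4, h5⟩
  · exact hin h3
  · by_cases hw : w ∈ C
    · obtain ⟨z, b, hz, hb, h6, h7, h8⟩ := last_exit h5 hy hw
      obtain ⟨f, f1, f2, f3, f4⟩ := h2 y hy
      have i1 := hin h3
      have i2 : r' (g a) (g y) := (h1 a ha y).1 h4
      have i3 := (f2 z).1 h6
      have i4 := (f4 z hz b hb).1.1 h7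
      exact ((i1.tail i2).trans (i3.tail i4)).trans (hin h8)
    · obtain ⟨f, f1, f2, f3, f4⟩ := h2 w hw
      have i2 := (f4 y hy a ha).2.1 h4
      have i3 := (f3 y).1 h5
      exact ((hin h3).tail i2).trans i3

theorem drop_reach_iff {V W : Type} {r : V → V → Prop} {r' : W → W → Prop} {C : Set V} {C' : Set W}
    (g : V ≃ W) (hg : ∀ x, x ∈ C ↔ g x ∈ C') (h1 : ∀ x ∈ C, ∀ w, r x w ↔ r' (g x) (g w))
    (h2 : ∀ y, y ∉ C → ∃ f : V ≃ W, (∀ z, z ∈ C ↔ f z ∈ C') ∧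
      (∀ z, Relation.ReflTransGen r y z ↔ Relation.ReflTransGen r' (g y) (f z)) ∧
      (∀ z, Relation.ReflTransGen r z y ↔ Relation.ReflTransGen r' (f z) (g y)) ∧
      ∀ z, z ∉ C → ∀ x ∈ C, (r z x ↔ r' (f z) (g x)) ∧ (r x z ↔ r' (g x) (f z)))
    {x w : V} (hx : x ∈ C) : Relation.ReflTransGen r x w ↔
    Relation.ReflTransGen r' (g x) (g w) := by
  refine ⟨drop_reach g hg h1 h2 hx, fun h => ?_⟩
  have := drop_reach (r := r') (r' := r) (C := C') (C' := C) g.symm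
    (fun x => by rw [hg, g.apply_symm_apply])
    (fun x hx w => by
      have := h1 (g.symm x) (by rw [hg, g.apply_symm_apply]; exact hx) (g.symm w)
      simpa using this.symm)
    (fun y hy => by
      obtain ⟨f, f1, f2, f3, f4⟩ := h2 (g.symm y) (by rw [hg, g.apply_symm_apply]; exact hy)
      refine ⟨f.symm, fun z => ?_, fun z => ?_, fun z => ?_, fun z hz x hx => ?_⟩
      · rw [f1, f.apply_symm_apply]
      · rw [f2, f.apply_symm_apply, g.apply_symm_apply]
      · rw [f3, f.apply_symm_apply, g.apply_symm_apply]
      · have := f4 (f.symm z) (by rw [f1, f.apply_symm_apply]; exact hz) (g.symm x)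
          (by rw [hg, g.apply_symm_apply]; exact hx)
        simp only [Equiv.apply_symm_apply] at this
        exact ⟨this.1.symm, this.2.symm⟩)
    ((hg x).1 hx) h
  simpa using this

end PartC

section PartD

variable {m : ℕ} {V W : Type} {G : SimpleGraph V} {H : SimpleGraph W}

/-- equal colours -/
def Col (G : SimpleGraph V) (H : SimpleGraph W) (α : Fin m → V) (β : Fin m → W)
    (J : Finset (Fin m)) (Γ : List (Coef m)) (x : V) (x' : W) : Prop :=
  (∀ i ∈ J, G.Adj x (α i) ↔ H.Adj x' (β i)) ∧ ∀ N ∈ Γ, rn G α N x = rn H β N x'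

open Classical in
/-- colours -/
noncomputable def col (G : SimpleGraph V) (α : Fin m → V) (J : Finset (Fin m))
    (Γ : List (Coef m)) (x : V) : (Fin m → Prop) × (Coef m → ℕ) :=
  (fun i => i ∈ J ∧ G.Adj x (α i), fun N => if N ∈ Γ then rn G α N x else 0)

theorem col_eq_iff {α : Fin m → V} {β : Fin m → W} {J : Finset (Fin m)} {Γ : List (Coef m)}
    {x : V} {x' : W} : col G α J Γ x = col H β J Γ x' ↔ Col G H α β J Γ x x' := by
  classical
  unfold col Col
  rw [Prod.mk.injEq, funext_iff, funext_iff]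
  refine and_congr (forall_congr' fun i => ?_) (forall_congr' fun N => ?_)
  · by_cases hi : i ∈ J <;> simp [hi]
  · by_cases hi : N ∈ Γ <;> simp [hi]

/-- the classes of `v` and `v'` are isomorphic, respecting colours -/
def IsoCl (G : SimpleGraph V) (H : SimpleGraph W) (α : Fin m → V) (β : Fin m → W)
    (J : Finset (Fin m)) (Γ0 Γ : List (Coef m)) (v : V) (v' : W) : Prop :=
  ∃ e : {x // SCL G α Γ v x} ≃ {x // SCL H β Γ v' x},
    (∀ x, x.1 = v ↔ (e x).1 = v') ∧
    (∀ x y, G.Adj x.1 y.1 ↔ H.Adj (e x).1 (e y).1) ∧ ∀ x, Col G H α β J Γ0 x.1 (e x).1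

theorem Col.mono {α : Fin m → V} {β : Fin m → W} {J J' : Finset (Fin m)} {Γ Γ' : List (Coef m)}
    {x : V} {x' : W} (hJ : J' ⊆ J) (hΓ : ∀ N ∈ Γ', N ∈ Γ) (h : Col G H α β J Γ x x') :
    Col G H α β J' Γ' x x' :=
  ⟨fun i hi => h.1 i (hJ hi), fun N hN => h.2 N (hΓ N hN)⟩

theorem IsoCl.mono {α : Fin m → V} {β : Fin m → W} {J J' : Finset (Fin m)}
    {Γ0 Γ0' Γ : List (Coef m)}
    {x : V} {x' : W} (hJ : J' ⊆ J) (hΓ : ∀ N ∈ Γ0', N ∈ Γ0) (h : IsoCl G H α β J Γ0 Γ x x') :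
    IsoCl G H α β J' Γ0' Γ x x' := by
  obtain ⟨e, h1, h2, h3⟩ := h
  exact ⟨e, h1, h2, fun x => (h3 x).mono hJ hΓ⟩

theorem Col.agree {α γ : Fin m → V} {β δ : Fin m → W} {J : Finset (Fin m)} {Γ : List (Coef m)}
    (hΓ : ∀ N ∈ Γ, Supp N J) (hα : ∀ i ∈ J, α i = γ i) (hβ : ∀ i ∈ J, β i = δ i)
    {x : V} {x' : W} (h : Col G H α β J Γ x x') : Col G H γ δ J Γ x x' := by
  refine ⟨fun i hi => ?_, fun N hN => ?_⟩
  · rw [← hα i hi, ← hβ i hi]; exact h.1 i hi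
  · rw [← rn_agree (hΓ N hN) hα, ← rn_agree (hΓ N hN) hβ]; exact h.2 N hN

theorem IsoCl.agree {α γ : Fin m → V} {β δ : Fin m → W} {J : Finset (Fin m)}
    {Γ0 Γ : List (Coef m)}
    (hΓ0 : ∀ N ∈ Γ0, Supp N J) (hΓ : ∀ N ∈ Γ, Supp N J) (hα : ∀ i ∈ J, α i = γ i)
    (hβ : ∀ i ∈ J, β i = δ i)
    {x : V} {x' : W} (h : IsoCl G H α β J Γ0 Γ x x') : IsoCl G H γ δ J Γ0 Γ x x' := by
  unfold IsoCl at h ⊢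
  rw [← SCL_agree hΓ hα, ← SCL_agree hΓ hβ]
  obtain ⟨e, h1, h2, h3⟩ := h
  exact ⟨e, h1, h2, fun x => (h3 x).agree hΓ0 hα hβ⟩

theorem cons_equiv {α : Fin m → V} {Γ : List (Coef m)} {N : Coef m} {v a u : V}
    (ha : SCL G α Γ v a) (hu : SCL G α (N :: Γ) a u) :
    ∃ E : {x : {x // SCL G α Γ v x} // SCL G α (N :: Γ) x.1 a} ≃ {x // SCL G α (N :: Γ) u x},
      ∀ x, (E x).1 = x.1.1 :=
  ⟨⟨fun x => ⟨x.1.1, (x.2.trans hu).symm⟩,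
    fun x => ⟨⟨x.1, ha.trans fun M hM => (hu.trans x.2) M (List.mem_cons_of_mem _ hM)⟩,
      (hu.trans x.2).symm⟩, fun _ => rfl, fun _ => rfl⟩, fun _ => rfl⟩

theorem glue_step [Fintype V] [Fintype W] {J : Finset (Fin m)} {Γ0 Γ : List (Coef m)} {N : Coef m}
    (hΓ0 : ∀ M ∈ Γ0, Supp M J) (hΓ : ∀ M ∈ Γ, M ∈ Γ0) (hN : N ∈ Γ0)
    {L r : ℕ} (hV : Fintype.card V ≤ 2 ^ L) (hW : Fintype.card W ≤ 2 ^ L) (hr : L ≤ r)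
    {α : Fin m → V} {β : Fin m → W} {j j1 l : Fin m} (hj : j ∉ J) (hj1 : j1 ∉ J) (hl : l ∉ J)
    (hjj1 : j ≠ j1) (hjl : j ≠ l) (hj1l : j1 ≠ l) (h : Eqv G H (r + 1) α β)
    (hyp : ∀ w w', SCL G α Γ (α j) w →
      Eqv G H r (Function.update α j1 w) (Function.update β j1 w') →
      IsoCl G H α β J Γ0 (N :: Γ) w w') : IsoCl G H α β J Γ0 Γ (α j) (β j) := by
  classical
  obtain ⟨f, hf⟩ := h.2 j1
  have hv : f (α j) = β j := by
    have := ((hf (α j)).atom j1 j).1.1 (by simp [Function.update_of_ne hjj1])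
    simpa [Function.update_of_ne hjj1] using this
  have tst : ∀ Δ : List (Coef m), (∀ M ∈ Δ, M ∈ Γ0) → ∀ x, SCL G α Δ (α j) x ↔ SCL H β Δ (β j) (f x) := by
    intro Δ hΔ x
    have hs : ∀ M ∈ Δ, Supp M J := fun M hM => hΓ0 M (hΔ M hM)
    have := scl_test hs hV hW hr hj hj1 hl hjj1 hjl hj1l (hf x)
    rw [SCL_agree hs (agree_update α hj1 x), SCL_agree hs (agree_update β hj1 (f x))] at this
    simpa only [Function.update_self, Function.update_of_ne hjj1] using this
  have hNΓ : ∀ M ∈ N :: Γ, M ∈ Γ0 := by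
    intro M hM
    rcases List.mem_cons.1 hM with rfl | h
    · exact hN
    · exact hΓ M h
  let s : Setoid {x // SCL G α Γ (α j) x} := ⟨fun x y => SCL G α (N :: Γ) x.1 y.1,
    fun x => SCL.refl _ _ _, fun h => h.symm, fun h h' => h.trans h'⟩
  let s' : Setoid {x // SCL H β Γ (β j) x} := ⟨fun x y => SCL H β (N :: Γ) x.1 y.1,
    fun x => SCL.refl _ _ _, fun h => h.symm, fun h h' => h.trans h'⟩
  obtain ⟨e, e1, e2⟩ := glue (A := {x // SCL G α Γ (α j) x}) (B := {x // SCL H β Γ (β j) x})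
    (fun x y => G.Adj x.1 y.1) (fun x y => H.Adj x.1 y.1)
    (fun x => (col G α J Γ0 x.1, x.1 = α j)) (fun x => (col H β J Γ0 x.1, x.1 = β j)) s s'
    (f.subtypeEquiv (tst Γ hΓ)) (by
      rintro ⟨a, ha⟩
      by_cases hva : SCL G α (N :: Γ) (α j) a
      · have hva' := (tst _ hNΓ a).1 hva
        obtain ⟨e, e0, e1, e2⟩ := hyp (α j) (β j) (SCL.refl _ _ _) (hv ▸ hf (α j))
        obtain ⟨E, hE⟩ := cons_equiv ha hva.symm
        obtain ⟨E', hE'⟩ := cons_equiv ((tst Γ hΓ a).1 ha) hva'.symm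
        have hE'' : ∀ y, (E'.symm y).1.1 = y.1 := fun y => by rw [← hE', E'.apply_symm_apply]
        refine ⟨E.trans (e.trans E'.symm), ?_, ?_⟩
        · intro x y
          simp only [Equiv.trans_apply]
          erw [hE'', hE'', ← e1, hE, hE]
        · intro x
          have h1 : (((E.trans (e.trans E'.symm)) x).1).1 = (e (E x)).1 := by
            simp only [Equiv.trans_apply]
            erw [hE'']
          have k1 := e0 (E x)
          have k2 := col_eq_iff.2 (e2 (E x))
          rw [hE] at k1 k2
          refine Prod.ext ?_ ?_
          · exact k2.trans (congrArg (col H β J Γ0) h1.symm)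
          · refine (propext k1).trans ?_
            exact congrArg (fun z => z = β j) h1.symm
      · have hva' : ¬ SCL H β (N :: Γ) (β j) (f a) := fun h => hva ((tst _ hNΓ a).2 h)
        obtain ⟨e, e0, e1, e2⟩ := hyp a (f a) ha (hf a)
        obtain ⟨E, hE⟩ := cons_equiv (N := N) ha (SCL.refl _ _ _)
        obtain ⟨E', hE'⟩ := cons_equiv (N := N) ((tst Γ hΓ a).1 ha) (SCL.refl _ _ _)
        have hE'' : ∀ y, (E'.symm y).1.1 = y.1 := fun y => by rw [← hE', E'.apply_symm_apply]
        refine ⟨E.trans (e.trans E'.symm), ?_, ?_⟩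
        · intro x y
          simp only [Equiv.trans_apply]
          erw [hE'', hE'', ← e1, hE, hE]
        · intro x
          have h1 : (((E.trans (e.trans E'.symm)) x).1).1 = (e (E x)).1 := by
            simp only [Equiv.trans_apply]
            erw [hE'']
          have k2 := col_eq_iff.2 (e2 (E x))
          rw [hE] at k2
          refine Prod.ext ?_ ?_
          · exact k2.trans (congrArg (col H β J Γ0) h1.symm)
          · refine (propext (iff_of_false ?_ ?_))
            · intro hc
              apply hva
              have := x.2
              change SCL G α (N :: Γ) x.1.1 a at this
              have hc' : x.1.1 = α j := hc
              rwa [hc'] at this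
            · intro hc
              apply hva'
              have hc' : (e (E x)).1 = β j := h1.symm.trans hc
              have := (e (E x)).2.symm
              rwa [hc'] at this)
    (by
      intro x y x' y' hxy hxy' cx cy
      have cx := col_eq_iff.1 (Prod.mk.inj cx).1
      have cy := col_eq_iff.1 (Prod.mk.inj cy).1
      refine interclass (hΓ0 N hN) cx.1 cy.1 (cx.2 N hN) (cy.2 N hN) (fun hc => hxy ?_)
        (fun hc => hxy' ?_)
      · intro M hM
        rcases List.mem_cons.1 hM with rfl | hM
        · exact hc M (List.mem_singleton.2 rfl)
        · exact (x.2.symm.trans y.2) M hM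
      · intro M hM
        rcases List.mem_cons.1 hM with rfl | hM
        · exact hc M (List.mem_singleton.2 rfl)
        · exact (x'.2.symm.trans y'.2) M hM)
  exact ⟨e, fun x => iff_of_eq (Prod.mk.inj (e2 x)).2, e1,
    fun x => col_eq_iff.1 (Prod.mk.inj (e2 x)).1⟩

theorem drop_step [Fintype V] [Fintype W] {J I : Finset (Fin m)} {Γ0 : List (Coef m)} {N1 : Coef m}
    (hI : I ⊆ J) (hN1 : Supp N1 I) (hΓ0 : ∀ M ∈ Γ0, Supp M J) (hmem : N1 ∈ Γ0)
    {L r : ℕ} (hV : Fintype.card V ≤ 2 ^ L) (hW : Fintype.card W ≤ 2 ^ L) (hr : L + 3 ≤ r)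
    {α : Fin m → V} {β : Fin m → W} {j jy jz l : Fin m} (hj : j ∉ J) (hjy : jy ∉ J) (hjz : jz ∉ J)
    (hl : l ∉ J) (jjy : j ≠ jy) (jjz : j ≠ jz) (jl : j ≠ l) (jyz : jy ≠ jz) (jyl : jy ≠ l)
    (jzl : jz ≠ l) (h : Eqv G H r α β)
    (iso : IsoCl G H α β I [N1] [N1] (α j) (β j))
    (det : ∀ x y, SCL G α [N1] (α j) x → SCL G α [N1] (α j) y →
      (∀ i ∈ I, G.Adj x (α i) ↔ G.Adj y (α i)) → ∀ i ∈ J, G.Adj x (α i) ↔ G.Adj y (α i)) :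
    IsoCl G H α β J Γ0 Γ0 (α j) (β j) := by
  classical
  have hN1J := hN1.mono hI
  have hN1L : ∀ M ∈ [N1], Supp M J := by
    intro M hM; rw [List.mem_singleton.1 hM]; exact hN1J
  obtain ⟨t, rfl⟩ : ∃ t, r = t + 2 := ⟨r - 2, by omega⟩
  have hLt : L + 1 ≤ t := by omega
  obtain ⟨σ, s0, s1, s2⟩ := iso
  obtain ⟨f, hf⟩ := h.2 jy
  have hC : ∀ x, SCL G α [N1] (α j) x ↔ SCL H β [N1] (β j) (f x) := by
    intro x
    have := scl_test hN1L hV hW (by omega) hj hjy hl jjy jl jyl (hf x)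
    rw [SCL_agree hN1L (agree_update α hjy x), SCL_agree hN1L (agree_update β hjy (f x))] at this
    simpa only [Function.update_self, Function.update_of_ne jjy] using this
  have hty : ∀ x, ∀ i ∈ J, G.Adj x (α i) ↔ H.Adj (f x) (β i) := by
    intro x i hi
    have := ((hf x).atom jy i).2
    rw [agree_update α hjy x i hi, agree_update β hjy _ i hi] at this
    simpa only [Function.update_self] using this
  have hrn : ∀ x, rn G α N1 x = rn H β N1 (f x) := by
    intro x
    have := rn_test hN1J hV hW (by omega) hjy hjz hl jyz jyl jzl (hf x)
    rw [rn_agree hN1J (agree_update α hjy x), rn_agree hN1J (agree_update β hjy _)] at this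
    simpa only [Function.update_self] using this
  have hσ : ∀ x, ∀ i ∈ J, G.Adj x.1 (α i) ↔ H.Adj (σ x).1 (β i) := by
    intro x i hi
    have h0 : SCL G α [N1] (α j) (f.symm (σ x).1) := by
      rw [hC, f.apply_symm_apply]; exact (σ x).2
    have := det x.1 (f.symm (σ x).1) x.2 h0 (by
      intro i hi
      rw [(s2 x).1 i hi, hty _ i (hI hi), f.apply_symm_apply]) i hi
    rw [this, hty _ i hi, f.apply_symm_apply]
  obtain ⟨g, g1, g2⟩ : ∃ g : V ≃ W, (∀ x (hx : SCL G α [N1] (α j) x), g x = (σ ⟨x, hx⟩).1) ∧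
      ∀ x, ¬ SCL G α [N1] (α j) x → g x = f x := by
    refine ⟨(Equiv.sumCompl (fun x => SCL G α [N1] (α j) x)).symm.trans
      ((Equiv.sumCongr σ (f.subtypeEquiv fun x => not_congr (hC x))).trans
        (Equiv.sumCompl (fun x => SCL H β [N1] (β j) x))), ?_, ?_⟩
    · intro x hx
      simp [Equiv.sumCompl_symm_apply_of_pos hx]
    · intro x hx
      simp [Equiv.sumCompl_symm_apply_of_neg hx]
  have gC : ∀ x, SCL G α [N1] (α j) x ↔ SCL H β [N1] (β j) (g x) := by
    intro x
    by_cases hx : SCL G α [N1] (α j) x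
    · rw [g1 x hx]; exact iff_of_true hx (σ _).2
    · rw [g2 x hx]; exact hC x
  have gty : ∀ x, ∀ i ∈ J, G.Adj x (α i) ↔ H.Adj (g x) (β i) := by
    intro x i hi
    by_cases hx : SCL G α [N1] (α j) x
    · rw [g1 x hx]; exact hσ ⟨x, hx⟩ i hi
    · rw [g2 x hx]; exact hty x i hi
  have grn : ∀ x, rn G α N1 x = rn H β N1 (g x) := by
    intro x
    by_cases hx : SCL G α [N1] (α j) x
    · rw [g1 x hx]; exact (s2 ⟨x, hx⟩).2 N1 (List.mem_singleton.2 rfl)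
    · rw [g2 x hx]; exact hrn x
  have gadj : ∀ x y, SCL G α [N1] (α j) x → (G.Adj x y ↔ H.Adj (g x) (g y)) := by
    intro x y hx
    by_cases hy : SCL G α [N1] (α j) y
    · rw [g1 x hx, g1 y hy]; exact s1 ⟨x, hx⟩ ⟨y, hy⟩
    · exact interclass hN1J (gty x) (gty y) (grn x) (grn y) (fun hc => hy (hx.trans hc))
        (fun hc => hy ((gC y).2 (((gC x).1 hx).trans hc)))
  have gv : g (α j) = β j := by
    rw [g1 _ (SCL.refl _ _ _)]; exact (s0 _).1 rfl
  have gre : ∀ N ∈ Γ0, ∀ x w, SCL G α [N1] (α j) x →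
      (Reach G α N x w ↔ Reach H β N (g x) (g w)) := by
    intro N hN x w hx
    have hNJ := hΓ0 N hN
    refine drop_reach_iff (C := {x | SCL G α [N1] (α j) x}) (C' := {x | SCL H β [N1] (β j) x})
      g gC (fun x hx w => Arc_congr hNJ (gty x) (gty w) (gadj x w hx)) ?_ hx
    intro y hy
    rw [g2 y hy]
    obtain ⟨p, hp⟩ := (hf y).2 jz
    have cα : ∀ z, ∀ i ∈ J, Function.update (Function.update α jy y) jz z i = α i := by
      intro z i hi
      rw [agree_update _ hjz z i hi, agree_update _ hjy y i hi]
    have cβ : ∀ z, ∀ i ∈ J, Function.update (Function.update β jy (f y)) jz z i = β i := by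
      intro z i hi
      rw [agree_update _ hjz z i hi, agree_update _ hjy _ i hi]
    have p1 : ∀ z, SCL G α [N1] (α j) z ↔ SCL H β [N1] (β j) (p z) := by
      intro z
      have := scl_test hN1L hV hW (by omega) hj hjz hl jjz jl jzl (hp z)
      rw [SCL_agree hN1L (cα z), SCL_agree hN1L (cβ (p z))] at this
      simpa only [Function.update_self, Function.update_of_ne jjz, Function.update_of_ne jjy]
        using this
    have pty : ∀ x, ∀ i ∈ J, G.Adj x (α i) ↔ H.Adj (p x) (β i) := by
      intro x i hi
      have := ((hp x).atom jz i).2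
      rw [cα x i hi, cβ _ i hi] at this
      simpa only [Function.update_self] using this
    have prn : ∀ x, rn G α N1 x = rn H β N1 (p x) := by
      intro x
      have := rn_test hN1J hV hW (by omega) hjz hjy hl jyz.symm jzl jyl (hp x)
      rw [rn_agree hN1J (cα x), rn_agree hN1J (cβ _)] at this
      simpa only [Function.update_self] using this
    have padj : ∀ z x, ¬ SCL G α [N1] (α j) z → SCL G α [N1] (α j) x →
        (G.Adj z x ↔ H.Adj (p z) (g x)) := by
      intro z x hz hx
      exact interclass hN1J (pty z) (gty x) (prn z) (grn x) (fun hc => hz (hx.trans hc.symm))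
        (fun hc => hz ((p1 z).2 (((gC x).1 hx).trans hc.symm)))
    refine ⟨p, p1, ?_, ?_, ?_⟩
    · intro z
      have := reach_test hNJ hV hW (by omega) hjy hjz hl jyz jyl jzl (hp z)
      rw [Reach_agree hNJ (cα z), Reach_agree hNJ (cβ (p z))] at this
      simp only [Function.update_self, Function.update_of_ne jyz] at this
      exact this
    · intro z
      have := reach_test hNJ hV hW (by omega) hjz hjy hl jyz.symm jzl jyl (hp z)
      rw [Reach_agree hNJ (cα z), Reach_agree hNJ (cβ (p z))] at this
      simp only [Function.update_self, Function.update_of_ne jyz] at this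
      exact this
    · intro z hz x hx
      refine ⟨Arc_congr hNJ (pty z) (gty x) (padj z x hz hx),
        Arc_congr hNJ (gty x) (pty z) ?_⟩
      rw [G.adj_comm, H.adj_comm]
      exact padj z x hz hx
  have hsub : ∀ x, SCL G α Γ0 (α j) x → SCL G α [N1] (α j) x := by
    intro x hx M hM
    rw [List.mem_singleton.1 hM]; exact hx N1 hmem
  have hsub' : ∀ x, SCL H β Γ0 (β j) x → SCL H β [N1] (β j) x := by
    intro x hx M hM
    rw [List.mem_singleton.1 hM]; exact hx N1 hmem
  have hS : ∀ x, SCL G α Γ0 (α j) x ↔ SCL H β Γ0 (β j) (g x) := by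
    intro x
    by_cases hx : SCL G α [N1] (α j) x
    · unfold SCL
      refine forall_congr' fun N => forall_congr' fun hN => ?_
      rw [gre N hN _ _ (SCL.refl _ _ _), gre N hN _ _ hx, gv]
    · exact iff_of_false (fun hc => hx (hsub x hc)) (fun hc => hx ((gC x).2 (hsub' _ hc)))
  refine ⟨g.subtypeEquiv hS, ?_, ?_, ?_⟩
  · intro x
    change _ ↔ g x.1 = β j
    rw [← gv]; exact g.injective.eq_iff.symm
  · intro x y; exact gadj x.1 y.1 (hsub _ x.2)
  · intro x
    refine ⟨gty x.1, fun N hN => ?_⟩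
    exact Nat.card_congr (g.subtypeEquiv fun w => gre N hN _ _ (hsub _ x.2))

end PartD

section PartE

set_option linter.unusedSectionVars false

variable {m : ℕ} {V : Type} [Fintype V] [DecidableEq V] {G : SimpleGraph V}

/-- rows of `A` span the rows of `Y` on the columns `Z` -/
def Spans (G : SimpleGraph V) (A Y Z : Finset V) : Prop :=
  ∀ y ∈ Y, ∃ c : V → ZMod 2, ∀ z ∈ Z, aF G y z = ∑ x ∈ A, c x * aF G x z

/-- zero-extended submatrix -/
noncomputable def MM (G : SimpleGraph V) (Y Z : Finset V) : Matrix V V (ZMod 2) :=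
  Matrix.of fun y z => if y ∈ Y ∧ z ∈ Z then aF G y z else 0

/-- rank of a submatrix -/
noncomputable def rk (G : SimpleGraph V) (Y Z : Finset V) : ℕ := (MM G Y Z).rank

theorem MM_transpose (Y Z : Finset V) : (MM G Y Z).transpose = MM G Z Y := by
  ext y z
  simp only [MM, Matrix.transpose_apply, Matrix.of_apply, and_comm, aF_symm G z y]

theorem rk_symm (Y Z : Finset V) : rk G Y Z = rk G Z Y := by
  unfold rk; rw [← MM_transpose Y Z, Matrix.rank_transpose]

theorem rk_mono_right {Y Z Z' : Finset V} (h : Z' ⊆ Z) : rk G Y Z' ≤ rk G Y Z := by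
  have : MM G Y Z' = MM G Y Z * Matrix.diagonal (fun z => if z ∈ Z' then 1 else 0) := by
    ext y z
    rw [Matrix.mul_diagonal]
    simp only [MM, Matrix.of_apply]
    by_cases h1 : y ∈ Y <;> by_cases h2 : z ∈ Z' <;> simp [h1, h2]
    intro h3; exact absurd (h h2) h3
  unfold rk
  rw [this]
  exact Matrix.rank_mul_le_left _ _

theorem rk_mono {Y Y' Z Z' : Finset V} (h : Z' ⊆ Z) (h' : Y' ⊆ Y) : rk G Y' Z' ≤ rk G Y Z :=
  (rk_mono_right h).trans (by rw [rk_symm, rk_symm Y]; exact rk_mono_right h')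

theorem rank_add_le' (A B : Matrix V V (ZMod 2)) : (A + B).rank ≤ A.rank + B.rank := by
  unfold Matrix.rank
  refine le_trans (Submodule.finrank_mono ?_) (Submodule.finrank_add_le_finrank_add_finrank _ _)
  rintro _ ⟨x, rfl⟩
  rw [Matrix.mulVecLin_add, LinearMap.add_apply]
  exact Submodule.add_mem_sup ⟨x, rfl⟩ ⟨x, rfl⟩

theorem rk_union_right {Y Z Z' : Finset V} (h : Disjoint Z Z') :
    rk G Y (Z ∪ Z') ≤ rk G Y Z + rk G Y Z' := by
  have : MM G Y (Z ∪ Z') = MM G Y Z + MM G Y Z' := by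
    ext y z
    simp only [MM, Matrix.of_apply, Matrix.add_apply]
    have := fun (u : z ∈ Z) (w : z ∈ Z') => Finset.disjoint_left.1 h u w
    by_cases h1 : y ∈ Y <;> by_cases h2 : z ∈ Z <;> by_cases h3 : z ∈ Z' <;> simp_all
  unfold rk
  rw [this]
  exact rank_add_le' _ _

theorem rk_sdiff {Y Z : Finset V} (h : Z ⊆ Y) :
    rk G (Y \ Z) (Y \ Z)ᶜ ≤ rk G Y Yᶜ + rk G Z Zᶜ := by
  have e : (Y \ Z)ᶜ = Yᶜ ∪ Z := by
    ext x; simp only [Finset.mem_compl, Finset.mem_sdiff, Finset.mem_union]; tauto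
  rw [e]
  refine (rk_union_right ?_).trans (add_le_add ?_ ?_)
  · rw [Finset.disjoint_left]
    intro x hx hz
    exact (Finset.mem_compl.1 hx) (h hz)
  · exact rk_mono subset_rfl Finset.sdiff_subset
  · rw [rk_symm]
    refine rk_mono ?_ subset_rfl
    intro x hx
    exact Finset.mem_compl.2 (Finset.mem_sdiff.1 hx).2

theorem rk_le_cutRank (X : Finset V) : rk G X Xᶜ ≤ cutRank G X := by
  classical
  let P : Matrix V ↥X (ZMod 2) := Matrix.of fun v x => if v = x.1 then 1 else 0
  let Q : Matrix ↥(Xᶜ) V (ZMod 2) := Matrix.of fun x v => if x.1 = v then 1 else 0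
  have : MM G X Xᶜ = P * ((Matrix.of fun (u : ↥X) (w : ↥(Xᶜ)) =>
      if G.Adj ↑u ↑w then (1 : ZMod 2) else 0) * Q) := by
    ext y z
    simp only [Matrix.mul_apply, P, Q, Matrix.of_apply, MM]
    split_ifs with h
    · rw [Finset.sum_eq_single ⟨y, h.1⟩, Finset.sum_eq_single ⟨z, h.2⟩]
      · simp [aF]
      · intro b _ hb
        rw [if_neg (fun hc => hb (Subtype.ext hc)), mul_zero]
      · simp
      · intro b _ hb
        rw [if_neg (fun hc => hb (Subtype.ext hc.symm)), zero_mul]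
      · simp
    · symm
      refine Finset.sum_eq_zero fun a _ => ?_
      by_cases hy : y = a.1
      · rw [Finset.sum_eq_zero, mul_zero]
        intro b _
        have hne : ¬ b.1 = z := fun hc => h ⟨hy ▸ a.2, hc ▸ b.2⟩
        rw [if_neg hne, mul_zero]
      · rw [if_neg hy, zero_mul]
  unfold rk cutRank
  rw [this]
  refine (Matrix.rank_mul_le_right _ _).trans ((Matrix.rank_mul_le_left _ _).trans (le_of_eq ?_))
  congr!

theorem Spans.mono {A A' Y Y' Z Z' : Finset V} (h : Spans G A Y Z) (hA : A ⊆ A') (hY : Y' ⊆ Y)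
    (hZ : Z' ⊆ Z) : Spans G A' Y' Z' := by
  intro y hy
  obtain ⟨c, hc⟩ := h y (hY hy)
  refine ⟨fun x => if x ∈ A then c x else 0, fun z hz => ?_⟩
  rw [hc z (hZ hz)]
  simp only [ite_mul, zero_mul]
  rw [← Finset.sum_filter]
  congr 1
  ext x; simp only [Finset.mem_filter]; exact ⟨fun h => ⟨hA h, h⟩, fun h => h.2⟩

theorem Spans.union {A Y Y' Z : Finset V} (h : Spans G A Y Z) (h' : Spans G A Y' Z) :
    Spans G A (Y ∪ Y') Z := by
  intro y hy
  rcases Finset.mem_union.1 hy with hy | hy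
  · exact h y hy
  · exact h' y hy

/-- restricted row -/
noncomputable def rowv (G : SimpleGraph V) (Z : Finset V) (y : V) : V → ZMod 2 :=
  fun z => if z ∈ Z then aF G y z else 0

theorem spans_iff {A Y Z : Finset V} : Spans G A Y Z ↔
    ∀ y ∈ Y, rowv G Z y ∈ Submodule.span (ZMod 2) (rowv G Z '' (A : Set V)) := by
  refine forall_congr' fun y => forall_congr' fun _ => ?_
  rw [Submodule.mem_span_image_finset_iff_exists_fun]
  constructor
  · rintro ⟨c, hc⟩
    refine ⟨fun i => c i.1, ?_⟩
    funext z
    rw [Finset.sum_apply]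
    unfold rowv
    by_cases hz : z ∈ Z
    · simp only [if_pos hz, hc z hz, Pi.smul_apply, smul_eq_mul]
      exact Finset.sum_coe_sort A (fun x => c x * aF G x z)
    · simp [if_neg hz]
  · rintro ⟨c, hc⟩
    refine ⟨fun x => if h : x ∈ A then c ⟨x, h⟩ else 0, fun z hz => ?_⟩
    have := congrFun hc z
    rw [Finset.sum_apply] at this
    simp only [rowv, if_pos hz, Pi.smul_apply, smul_eq_mul] at this
    rw [← this, ← Finset.sum_coe_sort A]
    refine Finset.sum_congr rfl fun x _ => ?_
    simp

theorem selection {A0 Y Z : Finset V} {K : ℕ} (hA : A0 ⊆ Y) (h : Spans G A0 Y Z)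
    (hr : rk G Y Z ≤ K) : ∃ A ⊆ A0, A.card ≤ K ∧ Spans G A Y Z := by
  classical
  obtain ⟨b, hb, hspan, hli⟩ := exists_linearIndependent (ZMod 2) (rowv G Z '' (A0 : Set V))
  obtain ⟨u, hu, hinj, him⟩ := (show Set.SurjOn (rowv G Z) (A0 : Set V) b from hb).exists_subset_injOn_image_eq
  have hAu : (((A0.filter (fun x => x ∈ u)) : Finset V) : Set V) = u := by
    ext x; simp only [Finset.coe_filter, Set.mem_setOf_eq]; exact ⟨fun h => h.2, fun h => ⟨hu h, h⟩⟩
  refine ⟨A0.filter (fun x => x ∈ u), Finset.filter_subset _ _, ?_, ?_⟩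
  · have hfin : b.Finite := (A0.finite_toSet.image _).subset hb
    haveI := hfin.fintype
    have h1 : (A0.filter (fun x => x ∈ u)).card = Fintype.card b := by
      rw [← Set.ncard_coe_finset, hAu, ← Set.ncard_image_of_injOn hinj, him,
        Set.ncard_eq_toFinset_card', Set.toFinset_card]
    have h2 : Module.finrank (ZMod 2) (Submodule.span (ZMod 2) b) = b.toFinset.card :=
      finrank_span_set_eq_card hli
    rw [h1, ← Set.toFinset_card, ← h2]
    refine le_trans ?_ hr
    unfold rk
    rw [Matrix.rank_eq_finrank_span_row]
    refine Submodule.finrank_mono (Submodule.span_mono ?_)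
    rintro _ hx
    obtain ⟨a, ha, rfl⟩ := hb hx
    refine ⟨a, ?_⟩
    funext z
    have : a ∈ Y := hA ha
    simp [MM, rowv, this, Matrix.row]
  · rw [spans_iff] at h ⊢
    intro y hy
    rw [hAu, him, hspan]
    exact h y hy

theorem exists_ginv (M : Matrix V V (ZMod 2)) : ∃ N : Matrix V V (ZMod 2), M * N * M = M := by
  let f := Matrix.toLin' M
  obtain ⟨s, hs⟩ := LinearMap.exists_rightInverse_of_surjective f.rangeRestrict
    (LinearMap.range_rangeRestrict f)
  obtain ⟨g, hg⟩ := LinearMap.exists_extend s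
  refine ⟨LinearMap.toMatrix' g, ?_⟩
  apply Matrix.toLin'.injective
  rw [Matrix.toLin'_mul, Matrix.toLin'_mul, Matrix.toLin'_toMatrix']
  refine LinearMap.ext fun x => ?_
  change f.comp g (f x) = f x
  have h1 : g (f x) = s ⟨f x, ⟨x, rfl⟩⟩ := by
    rw [← hg]; rfl
  have h2 := congrArg Subtype.val (LinearMap.congr_fun hs ⟨f x, ⟨x, rfl⟩⟩)
  rw [LinearMap.comp_apply, h1]
  exact h2

theorem exists_fit (hm : 0 < m) {A B X : Finset V} (hA : Spans G A X Xᶜ) (hB : Spans G B Xᶜ X)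
    (hAX : A ⊆ X) (hBX : B ⊆ Xᶜ) {I : Finset (Fin m)} {α : Fin m → V} (hI : A ∪ B ⊆ I.image α) :
    ∃ N : Coef m, Supp N I ∧ ∀ x ∈ X, ∀ y, y ∉ X → aF G x y = PP G α N x y := by
  classical
  have hch : ∀ v, ∃ i, v ∈ A ∪ B → i ∈ I ∧ α i = v := by
    intro v
    by_cases hv : v ∈ A ∪ B
    · obtain ⟨i, hi, hiv⟩ := Finset.mem_image.1 (hI hv)
      exact ⟨i, fun _ => ⟨hi, hiv⟩⟩
    · exact ⟨⟨0, hm⟩, fun h => absurd h hv⟩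
  choose ι hι using hch
  obtain ⟨N0, hN0⟩ := exists_ginv (MM G A B)
  refine ⟨fun i j => ∑ b ∈ B, ∑ a ∈ A, if ι b = i ∧ ι a = j then N0 b a else 0, ?_, ?_⟩
  · intro i j hij
    obtain ⟨b, hb, hb'⟩ := Finset.exists_ne_zero_of_sum_ne_zero hij
    obtain ⟨a, ha, ha'⟩ := Finset.exists_ne_zero_of_sum_ne_zero hb'
    have : ι b = i ∧ ι a = j := by
      by_contra hc; exact ha' (if_neg hc)
    rw [← this.1, ← this.2]
    exact ⟨(hι b (Finset.mem_union_right _ hb)).1, (hι a (Finset.mem_union_left _ ha)).1⟩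
  · intro x hx y hy
    have hy' : y ∈ Xᶜ := Finset.mem_compl.2 hy
    have e1 : PP G α (fun i j => ∑ b ∈ B, ∑ a ∈ A, if ι b = i ∧ ι a = j then N0 b a else 0) x y
        = ∑ b ∈ B, ∑ a ∈ A, aF G x b * N0 b a * aF G a y := by
      unfold PP
      simp only [Finset.mul_sum, Finset.sum_mul]
      rw [Finset.sum_congr rfl fun i _ => Finset.sum_comm, Finset.sum_comm]
      refine Finset.sum_congr rfl fun b hb => ?_
      rw [Finset.sum_congr rfl fun i _ => Finset.sum_comm, Finset.sum_comm]
      refine Finset.sum_congr rfl fun a ha => ?_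
      rw [Finset.sum_eq_single (ι b), Finset.sum_eq_single (ι a)]
      · rw [if_pos ⟨rfl, rfl⟩, (hι b (Finset.mem_union_right _ hb)).2,
          (hι a (Finset.mem_union_left _ ha)).2]
      · intro j _ hj
        rw [if_neg (fun h => hj h.2.symm)]; simp
      · simp
      · intro i _ hi
        refine Finset.sum_eq_zero fun j _ => ?_
        rw [if_neg (fun h => hi h.1.symm)]; simp
      · simp
    rw [e1]
    obtain ⟨c, hc⟩ := hA x hx
    obtain ⟨d, hd⟩ := hB y hy'
    -- entries of the generalized inverse identity
    have hent : ∀ a ∈ A, ∀ b ∈ B, ∑ b' ∈ B, ∑ a' ∈ A, aF G a b' * N0 b' a' * aF G a' b = aF G a b := by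
      intro a ha b hb
      have := congrFun (congrFun hN0 a) b
      rw [Matrix.mul_assoc, Matrix.mul_apply] at this
      simp only [Matrix.mul_apply, MM, Matrix.of_apply, ha, hb, true_and, and_true, ite_mul,
        mul_ite, zero_mul, mul_zero, if_true] at this
      rw [← Finset.sum_filter] at this
      simp only [← Finset.sum_filter, Finset.filter_mem_eq_inter, Finset.univ_inter] at this
      rw [← this]
      refine Finset.sum_congr rfl fun b' _ => ?_
      rw [Finset.mul_sum]
      refine Finset.sum_congr rfl fun a' _ => ?_
      ring
    have hxb : ∀ b ∈ B, aF G x b = ∑ a ∈ A, c a * aF G a b := fun b hb => hc b (hBX hb)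
    have hay : ∀ a ∈ A, aF G a y = ∑ b ∈ B, d b * aF G a b := by
      intro a ha
      rw [aF_symm, hd a (hAX ha)]
      exact Finset.sum_congr rfl fun b _ => by rw [aF_symm]
    have e2 : ∑ b ∈ B, ∑ a ∈ A, aF G x b * N0 b a * aF G a y =
        ∑ a ∈ A, ∑ b ∈ B, c a * d b * ∑ b' ∈ B, ∑ a' ∈ A, aF G a b' * N0 b' a' * aF G a' b := by
      have : ∀ b ∈ B, ∀ a ∈ A, aF G x b * N0 b a * aF G a y =
          ∑ a1 ∈ A, ∑ b1 ∈ B, c a1 * d b1 * (aF G a1 b * N0 b a * aF G a b1) := by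
        intro b hb a ha
        rw [hxb b hb, hay a ha, Finset.sum_mul, Finset.sum_mul]
        refine Finset.sum_congr rfl fun a1 _ => ?_
        rw [Finset.mul_sum]
        exact Finset.sum_congr rfl fun b1 _ => by ring
      rw [Finset.sum_congr rfl fun b hb => Finset.sum_congr rfl fun a ha => this b hb a ha]
      simp only [Finset.mul_sum]
      rw [Finset.sum_congr rfl fun b hb => Finset.sum_comm, Finset.sum_comm]
      refine Finset.sum_congr rfl fun a1 _ => ?_
      rw [Finset.sum_congr rfl fun b hb => Finset.sum_comm, Finset.sum_comm]
    rw [e2, hc y hy']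
    refine Finset.sum_congr rfl fun a ha => ?_
    rw [hay a ha, Finset.mul_sum]
    refine Finset.sum_congr rfl fun b hb => ?_
    rw [hent a ha b hb]; ring

end PartE

section PartF

set_option linter.unusedSectionVars false

variable {V : Type} [Fintype V] [DecidableEq V] {G : SimpleGraph V}

/-- balanced decompositions -/
inductive Bal (P : Finset V → Prop) : ℕ → Finset V → Prop
  | empty (d : ℕ) : Bal P d ∅
  | leaf (d : ℕ) (v : V) : P {v} → Bal P d {v}
  | node (d : ℕ) (X Y : Finset V) : P (X ∪ Y) → Disjoint X Y → Bal P d X → Bal P d Y →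
      Bal P (d + 1) (X ∪ Y)

theorem Bal.mono {P : Finset V → Prop} {d : ℕ} {X : Finset V} (h : Bal P d X) :
    ∀ {d' : ℕ}, d ≤ d' → Bal P d' X := by
  induction h with
  | empty d => intro d' _; exact .empty _
  | leaf d v hv => intro d' _; exact .leaf _ _ hv
  | node d X Y hP hd _ _ ih1 ih2 =>
    intro d' hd'
    obtain ⟨e, rfl⟩ : ∃ e, d' = e + 1 := ⟨d' - 1, by omega⟩
    exact .node _ _ _ hP hd (ih1 (by omega)) (ih2 (by omega))

/-- the path from `t` down to `s` has off-path subtrees `ws` -/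
inductive Plug : List (RWTree V) → RWTree V → RWTree V → Prop
  | nil (t : RWTree V) : Plug [] t t
  | left {ws : List (RWTree V)} {s l r : RWTree V} : Plug ws s l → Plug (r :: ws) s (.node l r)
  | right {ws : List (RWTree V)} {s l r : RWTree V} : Plug ws s r → Plug (l :: ws) s (.node l r)

/-- leaves of a list of trees -/
def mul (ws : List (RWTree V)) : Multiset V := (ws.map RWTree.leaves).sum

theorem Plug.leaves {ws : List (RWTree V)} {s t : RWTree V} (h : Plug ws s t) :
    t.leaves = mul ws + s.leaves := by
  induction h with
  | nil t => simp [mul]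
  | left _ ih => simp only [RWTree.leaves, ih, mul, List.map_cons, List.sum_cons]; abel
  | right _ ih => simp only [RWTree.leaves, ih, mul, List.map_cons, List.sum_cons]; abel

theorem self_mem_subtrees (t : RWTree V) : t ∈ t.subtrees := by
  cases t <;> simp [RWTree.subtrees]

theorem Plug.sub {ws : List (RWTree V)} {s t : RWTree V} (h : Plug ws s t) :
    ∀ u ∈ s.subtrees, u ∈ t.subtrees := by
  induction h with
  | nil t => exact fun u hu => hu
  | left _ ih => intro u hu; simp only [RWTree.subtrees, List.mem_cons, List.mem_append]; exact Or.inr (Or.inl (ih u hu))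
  | right _ ih => intro u hu; simp only [RWTree.subtrees, List.mem_cons, List.mem_append]; exact Or.inr (Or.inr (ih u hu))

theorem Plug.sub' {w s t : RWTree V} (h : Plug [w] s t) :
    ∀ u ∈ w.subtrees, u ∈ t.subtrees := by
  intro u hu
  cases h with
  | left h => simp [RWTree.subtrees, hu]
  | right h => simp [RWTree.subtrees, hu]

theorem Plug.split {pre post : List (RWTree V)} {s t : RWTree V} (h : Plug (pre ++ post) s t) :
    ∃ u, Plug pre u t ∧ Plug post s u := by
  induction pre generalizing t with
  | nil => exact ⟨t, .nil t, h⟩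
  | cons w pre ih =>
    cases h with
    | left h =>
      obtain ⟨u, h1, h2⟩ := ih h
      exact ⟨u, .left h1, h2⟩
    | right h =>
      obtain ⟨u, h1, h2⟩ := ih h
      exact ⟨u, .right h1, h2⟩

/-- good trees -/
def Good (G : SimpleGraph V) (k : ℕ) (t : RWTree V) : Prop :=
  t.leaves.Nodup ∧ ∀ s ∈ t.subtrees, rk G s.leaves.toFinset s.leaves.toFinsetᶜ ≤ k

theorem Good.plug {k : ℕ} {ws : List (RWTree V)} {s t : RWTree V} (hg : Good G k t)
    (h : Plug ws s t) : Good G k s := by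
  refine ⟨?_, fun u hu => hg.2 u (h.sub u hu)⟩
  have := hg.1
  rw [h.leaves, Multiset.nodup_add] at this
  exact this.2.1

theorem Good.plug' {k : ℕ} {w s t : RWTree V} (hg : Good G k t)
    (h : Plug [w] s t) : Good G k w := by
  refine ⟨?_, fun u hu => hg.2 u (h.sub' u hu)⟩
  have := hg.1
  rw [h.leaves, Multiset.nodup_add] at this
  simpa [mul] using this.1

theorem disj_of_nodup {s t : Multiset V} (h : (s + t).Nodup) :
    Disjoint s.toFinset t.toFinset := by
  rw [Multiset.nodup_add] at h
  rw [Multiset.disjoint_toFinset]; exact h.2.2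

theorem Good.region {k : ℕ} {ws : List (RWTree V)} {s t : RWTree V} (hg : Good G k t)
    (h : Plug ws s t) : rk G (mul ws).toFinset (mul ws).toFinsetᶜ ≤ 2 * k := by
  have h1 := hg.1
  rw [h.leaves] at h1
  have h2 := disj_of_nodup h1
  have h3 : (mul ws).toFinset = t.leaves.toFinset \ s.leaves.toFinset := by
    rw [h.leaves, Multiset.toFinset_add, Finset.union_sdiff_right]
    exact (Finset.sdiff_eq_self_of_disjoint h2).symm
  rw [h3]
  refine (rk_sdiff ?_).trans ?_
  · rw [h.leaves, Multiset.toFinset_add]; exact Finset.subset_union_right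
  · have a := hg.2 t (self_mem_subtrees t)
    have b := hg.2 s (h.sub s (self_mem_subtrees s))
    omega

theorem Good.whole {k : ℕ} {t : RWTree V} (hg : Good G k t) :
    rk G t.leaves.toFinset t.leaves.toFinsetᶜ ≤ 2 * k := by
  have a := hg.2 t (self_mem_subtrees t)
  omega

theorem heavy {n : ℕ} (t : RWTree V) (h : n ≤ t.leaves.card) :
    ∃ ws s, Plug ws s t ∧ n ≤ s.leaves.card ∧ ((∃ v, s = .leaf v) ∨
      ∃ l r, s = .node l r ∧ l.leaves.card < n ∧ r.leaves.card < n) := by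
  induction t with
  | leaf v => exact ⟨[], _, .nil _, h, Or.inl ⟨v, rfl⟩⟩
  | node l r ihl ihr =>
    by_cases h1 : n ≤ l.leaves.card
    · obtain ⟨ws, s, a, b⟩ := ihl h1
      exact ⟨_, s, .left a, b⟩
    by_cases h2 : n ≤ r.leaves.card
    · obtain ⟨ws, s, a, b⟩ := ihr h2
      exact ⟨_, s, .right a, b⟩
    exact ⟨[], _, .nil _, h, Or.inr ⟨l, r, rfl, by omega, by omega⟩⟩

theorem split_list {n : ℕ} (hn : 0 < n) (ws : List (RWTree V)) (h : n ≤ (mul ws).card) :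
    ∃ pre w post, ws = pre ++ w :: post ∧ (mul pre).card < n ∧
      n ≤ (mul pre).card + w.leaves.card := by
  induction ws generalizing n with
  | nil => simp [mul] at h; omega
  | cons w ws ih =>
    have hc : (mul (w :: ws)).card = w.leaves.card + (mul ws).card := by simp [mul]
    by_cases h1 : n ≤ w.leaves.card
    · exact ⟨[], w, ws, rfl, by simpa [mul] using hn, by omega⟩
    · obtain ⟨pre, w', post, e, h2, h3⟩ := ih (n := n - w.leaves.card) (by omega) (by omega)
      refine ⟨w :: pre, w', post, by simp [e], ?_, ?_⟩
      · have : (mul (w :: pre)).card = w.leaves.card + (mul pre).card := by simp [mul]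
        omega
      · have : (mul (w :: pre)).card = w.leaves.card + (mul pre).card := by simp [mul]
        omega

theorem balance {k : ℕ} (n : ℕ) :
    (∀ t : RWTree V, Good G k t → t.leaves.card < 2 ^ n →
      Bal (fun X => rk G X Xᶜ ≤ 2 * k) (4 * n) t.leaves.toFinset) ∧
    (∀ ws (s t : RWTree V), Good G k t → Plug ws s t → (mul ws).card < 2 ^ n →
      Bal (fun X => rk G X Xᶜ ≤ 2 * k) (4 * n + 2) (mul ws).toFinset) := by
  induction n with
  | zero =>
    constructor
    · intro t _ h
      exfalso
      have : ∀ t : RWTree V, 0 < t.leaves.card := by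
        intro t
        induction t with
        | leaf v => simp [RWTree.leaves]
        | node l r ihl _ => simp only [RWTree.leaves, Multiset.card_add]; omega
      have := this t
      omega
    · intro ws s t _ _ h
      have : mul ws = 0 := by rw [← Multiset.card_eq_zero]; omega
      rw [this]; exact .empty _
  | succ n ih =>
    have F : ∀ t : RWTree V, Good G k t → t.leaves.card < 2 ^ (n + 1) →
      Bal (fun X => rk G X Xᶜ ≤ 2 * k) (4 * (n + 1)) t.leaves.toFinset := by
      intro t hg ht
      by_cases hs : t.leaves.card < 2 ^ n
      · exact (ih.1 t hg hs).mono (by omega)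
      obtain ⟨ws, s, hp, h1, h2⟩ := heavy t (not_lt.1 hs)
      have e : t.leaves.toFinset = (mul ws).toFinset ∪ s.leaves.toFinset := by
        rw [hp.leaves, Multiset.toFinset_add]
      have hd : Disjoint (mul ws).toFinset s.leaves.toFinset :=
        disj_of_nodup (hp.leaves ▸ hg.1)
      have hc : t.leaves.card = (mul ws).card + s.leaves.card := by
        rw [hp.leaves, Multiset.card_add]
      have hgs := hg.plug hp
      have hB : Bal (fun X => rk G X Xᶜ ≤ 2 * k) (4 * n + 2) s.leaves.toFinset := by
        rcases h2 with ⟨v, rfl⟩ | ⟨l, r, rfl, hl, hr⟩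
        · have := hgs.whole
          simp only [RWTree.leaves, Multiset.toFinset_singleton] at this ⊢
          exact .leaf _ _ this
        · have g1 : Good G k l := hgs.plug (.left (.nil l))
          have g2 : Good G k r := hgs.plug (.right (.nil r))
          have hw := hgs.whole
          simp only [RWTree.leaves, Multiset.toFinset_add] at hw ⊢
          exact .node _ _ _ hw (disj_of_nodup hgs.1) ((ih.1 l g1 hl).mono (by omega))
            ((ih.1 r g2 hr).mono (by omega))
      have hR := ih.2 ws s t hg hp (by rw [pow_succ] at ht; omega)
      have hw := hg.whole
      rw [e] at hw ⊢
      exact (Bal.node _ _ _ hw hd hR hB).mono (by omega)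
    refine ⟨F, ?_⟩
    intro ws s t hg hp hc
    by_cases hs : (mul ws).card < 2 ^ n
    · exact (ih.2 ws s t hg hp hs).mono (by omega)
    obtain ⟨pre, w, post, rfl, h1, h2⟩ := split_list (by positivity) ws (not_lt.1 hs)
    obtain ⟨u, p1, p2⟩ := hp.split
    obtain ⟨u', p3, p4⟩ := Plug.split (pre := [w]) (post := post) p2
    have e2 : mul (w :: post) = w.leaves + mul post := by simp [mul]
    have e1 : mul (pre ++ w :: post) = mul pre + mul (w :: post) := by simp [mul]
    rw [e1, e2, Multiset.card_add, Multiset.card_add] at hc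
    have hw := F w ((hg.plug p1).plug' p3) (by omega)
    have hpost := ih.2 post s u' ((hg.plug p1).plug p3) p4 (by rw [pow_succ] at hc; omega)
    have hpre := ih.2 pre u t hg p1 h1
    have r1 := (hg.plug p1).region p2
    have r2 := hg.region hp
    have nd : (mul (pre ++ w :: post)).Nodup := by
      have := hg.1
      rw [hp.leaves, Multiset.nodup_add] at this
      exact this.1
    have d1 : Disjoint (mul pre).toFinset (mul (w :: post)).toFinset := disj_of_nodup (e1 ▸ nd)
    have nd2 : (mul (w :: post)).Nodup := by
      rw [e1, Multiset.nodup_add] at nd; exact nd.2.1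
    have d2 : Disjoint w.leaves.toFinset (mul post).toFinset := disj_of_nodup (e2 ▸ nd2)
    have b1 : Bal (fun X => rk G X Xᶜ ≤ 2 * k) (4 * n + 4 + 1) (mul (w :: post)).toFinset := by
      rw [e2, Multiset.toFinset_add] at r1 ⊢
      exact .node _ _ _ r1 d2 (hw.mono (by omega)) (hpost.mono (by omega))
    rw [e1, Multiset.toFinset_add] at r2 ⊢
    exact (Bal.node _ _ _ r2 d1 (hpre.mono (by omega)) b1).mono (by omega)

end PartF

section PartG

set_option linter.unusedSectionVars false

variable {m : ℕ} {V : Type} [Fintype V] [DecidableEq V] {G : SimpleGraph V}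

theorem exists_fresh (J : Finset (Fin m)) (h : J.card < m) : ∃ i, i ∉ J := by
  by_contra hc
  push Not at hc
  have : J = Finset.univ := Finset.eq_univ_iff_forall.2 hc
  rw [this, Finset.card_univ, Fintype.card_fin] at h
  omega

theorem fresh3 (J : Finset (Fin m)) (j : Fin m) (h : J.card + 4 ≤ m) :
    ∃ a b c, a ∉ J ∧ b ∉ J ∧ c ∉ J ∧ j ≠ a ∧ j ≠ b ∧ j ≠ c ∧ a ≠ b ∧ a ≠ c ∧ b ≠ c := by
  have h1 := Finset.card_insert_le j J
  obtain ⟨a, ha⟩ := exists_fresh (insert j J) (by omega)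
  have h2 := Finset.card_insert_le a (insert j J)
  obtain ⟨b, hb⟩ := exists_fresh (insert a (insert j J)) (by omega)
  have h3 := Finset.card_insert_le b (insert a (insert j J))
  obtain ⟨c, hc⟩ := exists_fresh (insert b (insert a (insert j J))) (by omega)
  simp only [Finset.mem_insert, not_or] at ha hb hc
  exact ⟨a, b, c, ha.2, hb.2.2, hc.2.2.2, ha.1 ∘ Eq.symm, hb.2.1 ∘ Eq.symm, hc.2.2.1 ∘ Eq.symm,
    hb.1 ∘ Eq.symm, hc.2.1 ∘ Eq.symm, hc.1 ∘ Eq.symm⟩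

theorem pebble {W : Type} {H : SimpleGraph W} (S : Finset V) :
    ∀ {r : ℕ} {α : Fin m → V} {β : Fin m → W} {J0 : Finset (Fin m)},
      J0.card + S.card ≤ m → Eqv G H (r + S.card) α β →
      ∃ α' β' J, Disjoint J J0 ∧ J.card ≤ S.card ∧ J.image α' = S ∧ (∀ i ∈ J0, α' i = α i) ∧
        (∀ i ∈ J0, β' i = β i) ∧ Eqv G H r α' β' := by
  induction S using Finset.induction_on with
  | empty =>
    intro r α β J0 _ h
    exact ⟨α, β, ∅, Finset.disjoint_empty_left _, le_rfl, rfl, fun _ _ => rfl, fun _ _ => rfl, h⟩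
  | insert v S hv ih =>
    intro r α β J0 hc h
    rw [Finset.card_insert_of_notMem hv] at hc h ⊢
    obtain ⟨i, hi⟩ := exists_fresh J0 (by omega)
    obtain ⟨f, hf⟩ := h.2 i
    obtain ⟨α', β', J, h1, h2, h3, h4, h5, h6⟩ := ih (J0 := insert i J0)
      (by have := Finset.card_insert_le i J0; omega) (hf v)
    refine ⟨α', β', insert i J, ?_, ?_, ?_, ?_, ?_, h6⟩
    · rw [Finset.disjoint_insert_left]
      exact ⟨hi, h1.mono_right (Finset.subset_insert _ _)⟩
    · have := Finset.card_insert_le i J; omega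
    · rw [Finset.image_insert, h3, h4 i (Finset.mem_insert_self _ _), Function.update_self]
    · intro a ha
      rw [h4 a (Finset.mem_insert_of_mem ha), agree_update α hi v a ha]
    · intro a ha
      rw [h5 a (Finset.mem_insert_of_mem ha), agree_update β hi _ a ha]

theorem index_sub {J : Finset (Fin m)} {α : Fin m → V} {T : Finset V} (h : T ⊆ J.image α) :
    ∃ I ⊆ J, I.image α = T ∧ I.card ≤ T.card := by
  classical
  have hs : Set.SurjOn α (J : Set (Fin m)) (T : Set V) := by
    intro v hv
    obtain ⟨i, hi, hiv⟩ := Finset.mem_image.1 (h hv)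
    exact ⟨i, hi, hiv⟩
  obtain ⟨u, hu, hinj, him⟩ := hs.exists_subset_injOn_image_eq
  have hAu : (((J.filter (fun x => x ∈ u)) : Finset (Fin m)) : Set (Fin m)) = u := by
    ext x; simp only [Finset.mem_coe, Finset.mem_filter]; exact ⟨fun h => h.2, fun h => ⟨hu h, h⟩⟩
  have him' : (J.filter (fun x => x ∈ u)).image α = T := by
    rw [← Finset.coe_inj, Finset.coe_image, hAu, him]
  refine ⟨J.filter (fun x => x ∈ u), Finset.filter_subset _ _, him', ?_⟩
  rw [← him', Finset.card_image_of_injOn (by rw [hAu]; exact hinj)]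

/-- isomorphism of classes for all positions in a set -/
def QQ (G : SimpleGraph V) (L : ℕ) (α : Fin m → V) (J : Finset (Fin m)) (Γ0 : List (Coef m))
    (X : Finset V) (r : ℕ) (Γ : List (Coef m)) : Prop :=
  ∀ (W : Type) [Fintype W] (H : SimpleGraph W), Fintype.card W ≤ 2 ^ L →
    ∀ (α' : Fin m → V) (β' : Fin m → W) (j : Fin m), (∀ i ∈ J, α' i = α i) → j ∉ J → α' j ∈ X →
      Eqv G H r α' β' → IsoCl G H α' β' J Γ0 Γ (α' j) (β' j)

theorem QQ.glue {L r : ℕ} (hV : Fintype.card V ≤ 2 ^ L) {α : Fin m → V} {J : Finset (Fin m)}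
    (hJ : J.card + 4 ≤ m)
    {Γ0 Γ : List (Coef m)} {N : Coef m} {X : Finset V}
    (hΓ0 : ∀ M ∈ Γ0, Supp M J) (hΓ : ∀ M ∈ Γ, M ∈ Γ0) (hN : N ∈ Γ0)
    (hcl : ∀ x ∈ X, ∀ y, SCL G α Γ x y → y ∈ X) (hr : L ≤ r)
    (h : QQ G L α J Γ0 X r (N :: Γ)) : QQ G L α J Γ0 X (r + 1) Γ := by
  intro W _ H hW α' β' j hα hj hjX hE
  obtain ⟨a, b, c, ha, hb, hc, ja, jb, jc, ab, ac, bc⟩ := fresh3 J j hJ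
  have hΓs : ∀ M ∈ Γ, Supp M J := fun M hM => hΓ0 M (hΓ M hM)
  refine glue_step hΓ0 hΓ hN hV hW hr hj ha hb ja jb ab hE ?_
  intro w w' hw hE'
  rw [SCL_agree hΓs hα] at hw
  have := h W H hW (Function.update α' a w) (Function.update β' a w') a
    (fun i hi => by rw [agree_update α' ha w i hi, hα i hi]) ha
    (by rw [Function.update_self]; exact hcl _ hjX _ hw) hE'
  simp only [Function.update_self] at this
  refine this.agree hΓ0 ?_ (agree_update α' ha w) (agree_update β' ha w')
  intro M hM
  rcases List.mem_cons.1 hM with rfl | hM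
  · exact hΓ0 _ hN
  · exact hΓs M hM

/-- the induction claim -/
def Claim (m : ℕ) (G : SimpleGraph V) (L K R : ℕ) (X A : Finset V) : Prop :=
  ∀ B ⊆ Xᶜ, B.card ≤ K → Spans G B Xᶜ X → ∀ (α : Fin m → V) (I : Finset (Fin m)) (N : Coef m),
    I.image α = A ∪ B → I.card ≤ A.card + B.card → Supp N I →
    (∀ x ∈ X, ∀ y, y ∉ X → aF G x y = PP G α N x y) →
    ∀ j, j ∉ I → α j ∈ X → ∀ (W : Type) [Fintype W] (H : SimpleGraph W),
      Fintype.card W ≤ 2 ^ L → ∀ β : Fin m → W, Eqv G H R α β →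
      IsoCl G H α β I [N] [N] (α j) (β j)

theorem half (hm : 0 < m) {L K R r : ℕ} (hV : Fintype.card V ≤ 2 ^ L) {X A C : Finset V}
    (hAX : A ⊆ X) (hA : Spans G A X Xᶜ) (hcl : Claim m G L K R X A)
    (hrk : rk G X Xᶜ ≤ K) (hC : C ⊆ Xᶜ) (hCs : Spans G C Xᶜ X) {α : Fin m → V}
    {J : Finset (Fin m)} (hJ : J.card + 4 ≤ m) (hJα : J.image α = A ∪ C) (hrR : R ≤ r)
    (hrL : L + 3 ≤ r) :
    ∃ N, Supp N J ∧ ∀ Γ0 : List (Coef m), N ∈ Γ0 → (∀ M ∈ Γ0, Supp M J) →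
      QQ G L α J Γ0 X r Γ0 := by
  obtain ⟨B, hBC, hBK, hB⟩ := selection (K := K) hC hCs ((rk_symm _ _).trans_le hrk)
  obtain ⟨I, hIJ, hI, hIc⟩ := index_sub (J := J) (α := α) (T := A ∪ B)
    (by rw [hJα]; exact Finset.union_subset_union_right hBC)
  obtain ⟨N, hNI, hfit⟩ := exists_fit hm hA hB hAX (hBC.trans hC) (I := I) (α := α) hI.ge
  refine ⟨N, hNI.mono hIJ, ?_⟩
  intro Γ0 hN hΓ0 W _ H hW α' β' j hα hj hjX hE
  obtain ⟨a, b, c, ha, hb, hc, ja, jb, jc, ab, ac, bc⟩ := fresh3 J j hJ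
  have hjI : j ∉ I := fun h => hj (hIJ h)
  have hαI : ∀ i ∈ I, α' i = α i := fun i hi => hα i (hIJ hi)
  have hfit' : ∀ x ∈ X, ∀ y, y ∉ X → aF G x y = PP G α' N x y := by
    intro x hx y hy
    rw [hfit x hx y hy]
    exact PP_congr hNI (fun i hi => by rw [hαI i hi]) (fun i hi => by rw [hαI i hi])
  have iso := hcl B (hBC.trans hC) hBK hB α' I N
    (by rw [← hI]; exact Finset.image_congr hαI)
    (hIc.trans (Finset.card_union_le _ _)) hNI hfit' j hjI hjX W H hW β' (hE.mono hrR)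
  refine drop_step hIJ hNI hΓ0 hN hV hW hrL hj ha hb hc ja jb jc ab ac bc hE iso ?_
  intro x y hx hy hxy i hi
  have hxX : x ∈ X := Fits_closed hfit' hjX (hx N (List.mem_singleton.2 rfl)).1
  have hyX : y ∈ X := Fits_closed hfit' hjX (hy N (List.mem_singleton.2 rfl)).1
  have hmem : α' i ∈ A ∪ C := by
    rw [hα i hi, ← hJα]; exact Finset.mem_image_of_mem _ hi
  rcases Finset.mem_union.1 hmem with h | h
  · have : α' i ∈ I.image α := by rw [hI]; exact Finset.mem_union_left _ h
    obtain ⟨i', hi', e⟩ := Finset.mem_image.1 this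
    rw [← e, ← hαI i' hi']
    exact hxy i' hi'
  · have hn : α' i ∉ X := Finset.mem_compl.1 (hC h)
    rw [← aF_eq_iff, hfit' x hxX _ hn, hfit' y hyX _ hn]
    exact PP_congr hNI hxy (fun _ _ => Iff.rfl)

theorem Bal.prop {P : Finset V → Prop} (h0 : P ∅) {d : ℕ} {X : Finset V} (h : Bal P d X) : P X := by
  cases h with
  | empty => exact h0
  | leaf _ v hv => exact hv
  | node d X Y h _ _ _ => exact h

theorem rk_empty (Z : Finset V) : rk G ∅ Z = 0 := by
  have : MM G ∅ Z = 0 := by ext y z; simp [MM]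
  unfold rk; rw [this, Matrix.rank_zero]

theorem main_claim {L K : ℕ} (hK : 1 ≤ K) (hm : m = 3 * K + 4) (hV : Fintype.card V ≤ 2 ^ L)
    {d : ℕ} {X : Finset V} (h : Bal (fun X => rk G X Xᶜ ≤ K) d X) :
    ∃ A ⊆ X, A.card ≤ K ∧ Spans G A X Xᶜ ∧ Claim m G L K ((2 * K + 2) * d + L + 3) X A := by
  induction h with
  | empty d =>
    refine ⟨∅, subset_rfl, Nat.zero_le _, fun y hy => absurd hy (Finset.notMem_empty _), ?_⟩
    intro B _ _ _ α I N _ _ _ _ j _ hj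
    exact absurd hj (Finset.notMem_empty _)
  | leaf d v hv =>
    refine ⟨{v}, subset_rfl, by simpa using hK, ?_, ?_⟩
    · intro y hy
      rw [Finset.mem_singleton.1 hy]
      exact ⟨fun _ => 1, fun z _ => by simp⟩
    intro B _ hB _ α I N _ hI hN hfit j hj hjv W _ H hW β hE
    have hIc : I.card + 4 ≤ m := by simp at hI; omega
    obtain ⟨a, b, c, ha, hb, hc, ja, jb, jc, ab, ac, bc⟩ := fresh3 I j hIc
    have hE1 : Eqv G H (L + 1 + 1) α β := hE.mono (by omega)
    obtain ⟨f, hf⟩ := hE1.2 a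
    have hNs : ∀ M ∈ [N], Supp M I := fun M hM => by rw [List.mem_singleton.1 hM]; exact hN
    have hcl : ∀ x, SCL G α [N] (α j) x ↔ SCL H β [N] (β j) (f x) := by
      intro x
      have := scl_test hNs hV hW (by omega) hj ha hb ja jb ab (hf x)
      rw [SCL_agree hNs (agree_update α ha x), SCL_agree hNs (agree_update β ha (f x))] at this
      simpa only [Function.update_self, Function.update_of_ne ja] using this
    have hfv : f (α j) = β j := by
      have := ((hf (α j)).atom a j).1.1 (by simp [Function.update_of_ne ja])
      simpa [Function.update_of_ne ja] using this
    have hone : ∀ x, SCL G α [N] (α j) x → x = α j := by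
      intro x hx
      have := Fits_closed hfit hjv (hx N (List.mem_singleton.2 rfl)).1
      rw [Finset.mem_singleton.1 this, Finset.mem_singleton.1 hjv]
    refine ⟨f.subtypeEquiv hcl, ?_, ?_, ?_⟩
    · intro x
      change _ ↔ f x.1 = β j
      rw [← hfv]; exact f.injective.eq_iff.symm
    · intro x y
      change _ ↔ H.Adj (f x.1) (f y.1)
      rw [hone x.1 x.2, hone y.1 y.2]
      exact iff_of_false (G.loopless.irrefl _) (H.loopless.irrefl _)
    · intro x
      change Col G H α β I [N] x.1 (f x.1)
      rw [hone x.1 x.2, hfv]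
      refine ⟨fun i _ => (hE.atom j i).2, fun M hM => ?_⟩
      exact rn_test (hNs M hM) hV hW (by omega) hj ha hb ja jb ab hE1
  | node d X1 X2 hP hd hb1 hb2 ih1 ih2 =>
    have h0 : rk G (∅ : Finset V) ∅ᶜ ≤ K := by rw [rk_empty]; omega
    have p1 := hb1.prop (P := fun X => rk G X Xᶜ ≤ K) h0
    have p2 := hb2.prop (P := fun X => rk G X Xᶜ ≤ K) h0
    obtain ⟨A1, hA1, c1, s1, cl1⟩ := ih1
    obtain ⟨A2, hA2, c2, s2, cl2⟩ := ih2
    have q1 : X2 ⊆ X1ᶜ := fun x hx => Finset.mem_compl.2 fun h => Finset.disjoint_left.1 hd h hx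
    have q2 : X1 ⊆ X2ᶜ := fun x hx => Finset.mem_compl.2 fun h => Finset.disjoint_left.1 hd hx h
    have k1 : (X1 ∪ X2)ᶜ ⊆ X1ᶜ := Finset.compl_subset_compl.2 Finset.subset_union_left
    have k2 : (X1 ∪ X2)ᶜ ⊆ X2ᶜ := Finset.compl_subset_compl.2 Finset.subset_union_right
    obtain ⟨A, hA, cA, sA⟩ := selection (G := G) (A0 := A1 ∪ A2) (Y := X1 ∪ X2)
      (Z := (X1 ∪ X2)ᶜ) (Finset.union_subset_union hA1 hA2)
      ((s1.mono Finset.subset_union_left subset_rfl k1).union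
        (s2.mono Finset.subset_union_right subset_rfl k2)) hP
    refine ⟨A, hA.trans (Finset.union_subset_union hA1 hA2), cA, sA, ?_⟩
    intro B hB cB sB α I N hIα hIc hN hfit j hj hjX W _ H hW β hE
    have hcu := Finset.card_union_le A1 A2
    have hcs := Finset.card_sdiff_add_card_eq_card hA
    have hji := Finset.card_insert_of_notMem hj
    obtain ⟨α', β', J', hdis, hJc, hJ', hα, hβ, hE'⟩ := pebble ((A1 ∪ A2) \ A)
      (r := (2 * K + 2) * d + L + 3 + 1 + 1) (J0 := insert j I) (by omega)
      (hE.mono (by rw [mul_add]; omega))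
    have hαI : ∀ i ∈ I, α' i = α i := fun i hi => hα i (Finset.mem_insert_of_mem hi)
    have hβI : ∀ i ∈ I, β' i = β i := fun i hi => hβ i (Finset.mem_insert_of_mem hi)
    have hjα := hα j (Finset.mem_insert_self _ _)
    have hjβ := hβ j (Finset.mem_insert_self _ _)
    have hJim : (I ∪ J').image α' = A1 ∪ A2 ∪ B := by
      rw [Finset.image_union, hJ', Finset.image_congr hαI, hIα]
      ext x
      have := @hA x
      simp only [Finset.mem_union, Finset.mem_sdiff] at this ⊢
      tauto
    have hJcard : (I ∪ J').card + 4 ≤ m := by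
      have := Finset.card_union_le I J'
      omega
    have hjJ : j ∉ I ∪ J' := by
      rw [Finset.mem_union, not_or]
      exact ⟨hj, fun h => Finset.disjoint_left.1 hdis h (Finset.mem_insert_self _ _)⟩
    have hfit' : ∀ x ∈ X1 ∪ X2, ∀ y, y ∉ X1 ∪ X2 → aF G x y = PP G α' N x y := by
      intro x hx y hy
      rw [hfit x hx y hy]
      exact PP_congr hN (fun i hi => by rw [hαI i hi]) (fun i hi => by rw [hαI i hi])
    have e1 : X1ᶜ ⊆ X2 ∪ (X1 ∪ X2)ᶜ := by
      intro x; simp only [Finset.mem_compl, Finset.mem_union]; tauto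
    have e2 : X2ᶜ ⊆ X1 ∪ (X1 ∪ X2)ᶜ := by
      intro x; simp only [Finset.mem_compl, Finset.mem_union]; tauto
    obtain ⟨N1, hN1, Q1⟩ := half (by omega) hV hA1 s1 cl1 p1 (C := A2 ∪ B)
      (Finset.union_subset (hA2.trans q1) (hB.trans k1))
      (((s2.mono Finset.subset_union_left subset_rfl q2).union
        (sB.mono Finset.subset_union_right subset_rfl Finset.subset_union_left)).mono subset_rfl
          e1 subset_rfl)
      hJcard (by rw [hJim, Finset.union_assoc]) le_rfl (by omega)
    obtain ⟨N2, hN2, Q2⟩ := half (by omega) hV hA2 s2 cl2 p2 (C := A1 ∪ B)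
      (Finset.union_subset (hA1.trans q2) (hB.trans k2))
      (((s1.mono Finset.subset_union_left subset_rfl q1).union
        (sB.mono Finset.subset_union_right subset_rfl Finset.subset_union_right)).mono subset_rfl
          e2 subset_rfl)
      hJcard (by rw [hJim, Finset.union_comm A1 A2, Finset.union_assoc]) le_rfl (by omega)
    have hNJ : Supp N (I ∪ J') := hN.mono Finset.subset_union_left
    have hΓ0 : ∀ M ∈ [N2, N1, N], Supp M (I ∪ J') := by
      intro M hM
      simp only [List.mem_cons, List.not_mem_nil, or_false] at hM
      rcases hM with rfl | rfl | rfl <;> assumption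
    have QA : QQ G L α' (I ∪ J') [N2, N1, N] (X1 ∪ X2) ((2 * K + 2) * d + L + 3) [N2, N1, N] := by
      intro W _ H hW α'' β'' j' h1 h2 h3 h4
      rcases Finset.mem_union.1 h3 with h3 | h3
      · exact Q1 _ (by simp) hΓ0 W H hW α'' β'' j' h1 h2 h3 h4
      · exact Q2 _ (by simp) hΓ0 W H hW α'' β'' j' h1 h2 h3 h4
    have hclo : ∀ Γ : List (Coef m), N ∈ Γ → ∀ x ∈ X1 ∪ X2, ∀ y, SCL G α' Γ x y → y ∈ X1 ∪ X2 :=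
      fun Γ hΓ x hx y hxy => Fits_closed hfit' hx (hxy N hΓ).1
    have QB := QA.glue hV hJcard hΓ0 (by simp) (by simp) (hclo _ (by simp)) (by omega)
    have QC := QB.glue hV hJcard hΓ0 (by simp) (by simp) (hclo _ (by simp)) (by omega)
    have iso := QC W H hW α' β' j (fun _ _ => rfl) hjJ (by rw [hjα]; exact hjX) hE'
    rw [hjα, hjβ] at iso
    have hNs : ∀ M ∈ [N], Supp M I := fun M hM => by rw [List.mem_singleton.1 hM]; exact hN
    exact (iso.mono (J' := I) (Γ0' := [N]) Finset.subset_union_left (by simp)).agree hNs hNs hαI hβI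

end PartG

section PartH

theorem root_iso {m : ℕ} {V : Type} [Fintype V] [DecidableEq V] {G : SimpleGraph V} {L K R r : ℕ}
    (hm : m = 3 * K + 4) (hV : Fintype.card V ≤ 2 ^ L) (hR : L ≤ R)
    {A : Finset V} (hA : A.card ≤ K) (hcl : Claim m G L K R Finset.univ A)
    (hr : R + 1 + K ≤ r) {W : Type} [Fintype W] {H : SimpleGraph W} {γ : Fin m → V}
    {β : Fin m → W} (h : Eqv G H r γ β) : Nonempty (G ≃g H) := by
  have h' : Eqv G H (R + 1 + A.card) γ β := h.mono (by omega)
  have hW : Fintype.card W ≤ 2 ^ L := by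
    have h1 : Eqv G H (R + A.card + 1) γ β := by
      have e : R + A.card + 1 = R + 1 + A.card := by omega
      rw [e]; exact h'
    obtain ⟨f, _⟩ := h1.2 ⟨0, by omega⟩
    rw [← Fintype.card_congr f]; exact hV
  obtain ⟨α', β', J, _, hJc, hJ, _, _, hE⟩ := pebble A (J0 := ∅) (by simp; omega) h'
  have hJ4 : J.card + 4 ≤ m := by omega
  have hs : ∀ M ∈ [(0 : Coef m)], Supp M J := by
    intro M hM i j hij
    rw [List.mem_singleton.1 hM] at hij
    exact absurd rfl hij
  have hQ : QQ G L α' J [0] Finset.univ R [0] := by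
    intro W _ H hW α'' β'' j h1 h2 h3 h4
    refine hcl ∅ (Finset.empty_subset _) (Nat.zero_le _) ?_ α'' J 0 ?_ (by simpa using hJc)
      (hs 0 (by simp)) ?_ j h2 h3 W H hW β'' h4
    · intro y hy; simp at hy
    · rw [Finset.union_empty, ← hJ]; exact Finset.image_congr h1
    · intro x _ y hy; exact absurd (Finset.mem_univ y) hy
  have hQ' := hQ.glue hV hJ4 hs (by simp) (by simp) (fun _ _ _ _ => Finset.mem_univ _) hR
  obtain ⟨j, hj⟩ := exists_fresh J (by omega)
  obtain ⟨e, _, e1, _⟩ := hQ' W H hW α' β' j (fun _ _ => rfl) hj (Finset.mem_univ _) hE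
  have t1 : ∀ x, SCL G α' [] (α' j) x := fun x N hN => absurd hN (List.not_mem_nil)
  have t2 : ∀ x, SCL H β' [] (β' j) x := fun x N hN => absurd hN (List.not_mem_nil)
  refine ⟨⟨(Equiv.subtypeUnivEquiv t1).symm.trans (e.trans (Equiv.subtypeUnivEquiv t2)), ?_⟩⟩
  intro x y
  exact (e1 ⟨x, t1 x⟩ ⟨y, t1 y⟩).symm

end PartH

/-- For every `k ≥ 1` there is a constant `c` such that every graph `G` of
rank width at most `k` on `n` vertices is characterized up to isomorphism by a sentence
`φ_G` of first-order logic with counting with at most `6k+4` variables and quantifier depth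
at most `c · (log₂ n + 1)`: `G ⊨ φ_G`, and `H ⊭ φ_G` for every graph `H ≇ G`. -/
theorem counting_logic_characterization_bounded_rankwidth (k : ℕ) (hk : 1 ≤ k) :
    ∃ c : ℕ, ∀ (V : Type) [Fintype V] [DecidableEq V] (G : SimpleGraph V),
      RankwidthLE G k →
      ∃ φ : CFormula (6 * k + 4),
        φ.freeVars = ∅ ∧
        φ.qdepth ≤ c * (Nat.log 2 (Fintype.card V) + 1) ∧
        (∀ α : Fin (6 * k + 4) → V, CFormula.Sat G φ α) ∧
        (∀ (W : Type) [Fintype W] [DecidableEq W] (H : SimpleGraph W),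
          ¬ Nonempty (G ≃g H) → ∀ α : Fin (6 * k + 4) → W, ¬ CFormula.Sat H φ α) := by
  refine ⟨24 * k + 17, ?_⟩
  intro V _ _ G hG
  obtain ⟨t, ht, hrw⟩ := hG
  have hgood : Good G k t :=
    ⟨by rw [ht]; exact Finset.univ.nodup, fun s hs => (rk_le_cutRank _).trans (hrw s hs)⟩
  have hlt : Fintype.card V < 2 ^ (Nat.log 2 (Fintype.card V) + 1) :=
    Nat.lt_pow_succ_log_self (by norm_num) _
  generalize hL : Nat.log 2 (Fintype.card V) + 1 = L at hlt ⊢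
  have hL1 : 1 ≤ L := by omega
  have hbal := (balance (G := G) (k := k) L).1 t hgood (by rw [ht]; exact hlt)
  have huniv : t.leaves.toFinset = Finset.univ := by
    rw [ht]; exact Finset.val_toFinset _
  rw [huniv] at hbal
  obtain ⟨A, _, hA, _, hcl⟩ := main_claim (m := 6 * k + 4) (K := 2 * k) (by omega) (by omega)
    hlt.le hbal
  have hne : Nonempty V := by
    cases t with
    | leaf v => exact ⟨v⟩
    | node l r =>
      have : ∀ t : RWTree V, Nonempty V := by
        intro t
        induction t with
        | leaf v => exact ⟨v⟩
        | node _ _ ih _ => exact ih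
      exact this l
  obtain ⟨v0⟩ := hne
  obtain ⟨φ, h1, h2, h3, h4⟩ := exists_sentence (m := 6 * k + 4) (by omega) G (fun _ => v0)
    ((2 * (2 * k) + 2) * (4 * L) + L + 3 + 1 + 2 * k)
  refine ⟨φ, h1, ?_, h3, ?_⟩
  · refine h2.trans ?_
    nlinarith
  · intro W _ _ H hne α hs
    obtain ⟨β, hβ⟩ := h4 W H α hs
    exact hne (root_iso (by omega) hlt.le (by omega) hA hcl le_rfl hβ)
end

section
/- There is an absolute constant c such that the following holds. Let G and H be finite simple graphs with |V(G)| = |V(H)| = n, let u, v ∈ V(G) lie in the same connected component of G, and let u', v' ∈ V(H) lie in different connected components of H. Then the 2-dimensional Weisfeiler–Leman algorithm run for at most c·(log₂ n + 1) rounds distinguishes the pair (u,v) from the pair (u',v'); that is, χ^G_{2,r}((u,v)) ≠ χ^H_{2,r}((u',v')) for r = ⌈c·(log₂ n + 1)⌉. -/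
/-!
Statement 0: the (6k+3)-dimensional Weisfeiler--Leman algorithm identifies graphs of
rank width ≤ k in O(log n) rounds.
-/

/-- The type of color values computed by the `k`-dimensional Weisfeiler--Leman algorithm
after `r` refinement steps (index `0` is the initial/atomic coloring, so index `r`
corresponds to `r + 1` rounds in the convention where the initial coloring is round one). -/
def WLColorType (k : ℕ) (C : Type) : ℕ → Type
  | 0 => (Fin k → Fin k → Prop) × (Fin k → Fin k → Prop) × (Fin k → C)
  | (r + 1) => WLColorType k C r × Multiset (Fin k → WLColorType k C r)

/-- The `k`-WL coloring of `k`-tuples of vertices of a vertex-colored graph `(G, χ)`: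
`wlColor G χ k 0 v̄` is the atomic type of `v̄` (the equality pattern, the adjacency
pattern, and the vertex colors), and
`wlColor G χ k (r+1) v̄ = (wlColor G χ k r v̄, {{(colors of v̄ with i-th entry replaced by x)ᵢ : x ∈ V}})`. -/
def wlColor {V C : Type} [Fintype V] [DecidableEq V] (G : SimpleGraph V) (χ : V → C) (k : ℕ) :
    (r : ℕ) → (Fin k → V) → WLColorType k C r
  | 0 => fun vb => (fun i j => vb i = vb j, fun i j => G.Adj (vb i) (vb j), fun i => χ (vb i))
  | (r + 1) => fun vb =>
      (wlColor G χ k r vb,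
        (Finset.univ : Finset V).val.map fun x i => wlColor G χ k r (Function.update vb i x))

theorem wl_conn_aux {V W : Type} [Fintype V] [DecidableEq V] [Fintype W] [DecidableEq W]
    (G : SimpleGraph V) (H : SimpleGraph W) (r : ℕ) :
    ∀ (u v : V) (u' v' : W) (p : G.Walk u v), p.length ≤ 2 ^ r →
      wlColor G (fun _ => ()) 2 r ![u, v] = wlColor H (fun _ => ()) 2 r ![u', v'] →
      H.Reachable u' v' := by
  induction r with
  | zero =>
    intro u v u' v' p hp h
    have h1 : (fun i j : Fin 2 => (![u, v] i = ![u, v] j)) = fun i j => (![u', v'] i = ![u', v'] j) :=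
      congrArg Prod.fst h
    have h2 : (fun i j : Fin 2 => G.Adj (![u, v] i) (![u, v] j)) =
        fun i j => H.Adj (![u', v'] i) (![u', v'] j) :=
      congrArg (fun x => x.2.1) h
    have e1 : (u = v) = (u' = v') := congrFun (congrFun h1 0) 1
    have e2 : G.Adj u v = H.Adj u' v' := congrFun (congrFun h2 0) 1
    cases p with
    | nil =>
      have : u' = v' := e1 ▸ rfl
      subst this
      exact SimpleGraph.Reachable.refl _
    | cons hadj q =>
      cases q with
      | nil => exact (e2 ▸ hadj : H.Adj u' v').reachable
      | cons _ q => simp at hp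
  | succ r ih =>
    intro u v u' v' p hp h
    have h2 : ((Finset.univ : Finset V).val.map fun x (i : Fin 2) =>
          wlColor G (fun _ => ()) 2 r (Function.update ![u, v] i x)) =
        ((Finset.univ : Finset W).val.map fun x (i : Fin 2) =>
          wlColor H (fun _ => ()) 2 r (Function.update ![u', v'] i x)) :=
      congrArg Prod.snd h
    have hx := Multiset.mem_map_of_mem (fun x (i : Fin 2) =>
          wlColor G (fun _ => ()) 2 r (Function.update ![u, v] i x))
          (Finset.mem_univ_val (p.getVert (2 ^ r)))
    rw [h2, Multiset.mem_map] at hx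
    obtain ⟨y, -, hy⟩ := hx
    have a := (congrFun hy 0).symm
    have b := (congrFun hy 1).symm
    have up0 : ∀ {A : Type} (s t z : A), Function.update ![s, t] 0 z = ![z, t] := by
      intro A s t z; ext i; fin_cases i <;> simp
    have up1 : ∀ {A : Type} (s t z : A), Function.update ![s, t] 1 z = ![s, z] := by
      intro A s t z; ext i; fin_cases i <;> simp
    simp only [up0, up1] at a b
    refine (ih _ _ _ _ (p.take (2 ^ r)) ?_ b).trans (ih _ _ _ _ (p.drop (2 ^ r)) ?_ a)
    · simp [SimpleGraph.Walk.take_length]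
    · rw [SimpleGraph.Walk.drop_length]; rw [pow_succ] at hp; omega

/-- **Connectivity Lemma.** There is an absolute constant `c` such that for
all `n`-vertex graphs `G`, `H`, if `u, v ∈ V(G)` lie in the same connected component of `G`
while `u', v' ∈ V(H)` lie in different connected components of `H`, then `2`-dimensional WL
run for at most `c · (log₂ n + 1)` rounds assigns `(u, v)` and `(u', v')` different colors. -/
theorem two_dim_wl_distinguishes_connectivity_in_log_rounds :
    ∃ c : ℕ, ∀ (V W : Type) [Fintype V] [DecidableEq V] [Fintype W] [DecidableEq W]
      (G : SimpleGraph V) (H : SimpleGraph W),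
      Fintype.card V = Fintype.card W →
      ∀ (u v : V) (u' v' : W), G.Reachable u v → ¬ H.Reachable u' v' →
      wlColor G (fun _ => ()) 2 (c * (Nat.log 2 (Fintype.card V) + 1)) ![u, v] ≠
        wlColor H (fun _ => ()) 2 (c * (Nat.log 2 (Fintype.card V) + 1)) ![u', v'] := by
  refine ⟨1, ?_⟩
  intro V W _ _ _ _ G H _ u v u' v' hG hH h
  obtain ⟨p⟩ := hG
  refine hH (wl_conn_aux G H _ u v u' v' p.toPath.1 ?_ h)
  have h1 := p.toPath.2.length_lt
  have h2 := Nat.lt_pow_succ_log_self (b := 2) (by norm_num) (Fintype.card V)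
  rw [one_mul]
  exact (h1.trans h2).le
end

section
/- Let G be a finite simple graph, X ⊆ V(G), and (A, B) a split pair for X. If v, w ∈ X satisfy N(v) ∩ B = N(w) ∩ B, then v ≈_X w, i.e., N(v) ∩ X̄ = N(w) ∩ X̄. Similarly, if v', w' ∈ X̄ satisfy N(v') ∩ A = N(w') ∩ A, then v' ≈_{X̄} w', i.e., N(v') ∩ X = N(w') ∩ X. -/
/-- `vec_X(v) ∈ F₂^{X̄}`: the characteristic vector of `N(v) ∩ X̄`, where `X̄ = V ∖ X`. -/
def vecCut {V : Type} [Fintype V] [DecidableEq V] (G : SimpleGraph V) [DecidableRel G.Adj]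
    (X : Finset V) (v : V) : ↥(Xᶜ) → ZMod 2 :=
  fun w => if G.Adj v ↑w then 1 else 0

/-- The set `S` is an `F₂`-linear basis of the span of the set `T`. -/
def IsBasisOfSpan {M : Type} [AddCommMonoid M] [Module (ZMod 2) M] (S T : Set M) : Prop :=
  LinearIndependent (ZMod 2) ((↑) : S → M) ∧
    Submodule.span (ZMod 2) S = Submodule.span (ZMod 2) T

/-- `(A, B)` is a split pair for `X`: `A ⊆ X`, `B ⊆ X̄`, `{vec_X(a) : a ∈ A}` is a basis of
the span of `{vec_X(v) : v ∈ X}`, and `{vec_X̄(b) : b ∈ B}` is a basis of the span of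
`{vec_X̄(v) : v ∈ X̄}`. -/
def IsSplitPair {V : Type} [Fintype V] [DecidableEq V] (G : SimpleGraph V) [DecidableRel G.Adj]
    (X A B : Finset V) : Prop :=
  A ⊆ X ∧ B ⊆ Xᶜ ∧
    IsBasisOfSpan (vecCut G X '' ↑A) (vecCut G X '' ↑X) ∧
    IsBasisOfSpan (vecCut G Xᶜ '' ↑B) (vecCut G Xᶜ '' ↑(Xᶜ))

theorem vecCut_key {V : Type} [Fintype V] [DecidableEq V]
    (G : SimpleGraph V) [DecidableRel G.Adj] (Y C : Finset V)
    (hs : Submodule.span (ZMod 2) (vecCut G Y '' ↑C) = Submodule.span (ZMod 2) (vecCut G Y '' ↑Y))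
    (hC : C ⊆ Y) (v w : V) (hv : v ∈ Yᶜ) (hw : w ∈ Yᶜ)
    (h : G.neighborFinset v ∩ C = G.neighborFinset w ∩ C) :
    G.neighborFinset v ∩ Y = G.neighborFinset w ∩ Y := by
  have key : ∀ f ∈ Submodule.span (ZMod 2) (vecCut G Y '' ↑C), f ⟨v, hv⟩ = f ⟨w, hw⟩ := by
    intro f hf
    induction hf using Submodule.span_induction with
    | mem x hx =>
      obtain ⟨c, hc, rfl⟩ := hx
      have h1 := Finset.ext_iff.1 h c
      have hc' : c ∈ C := hc
      simp only [Finset.mem_inter, SimpleGraph.mem_neighborFinset, hc', and_true] at h1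
      simp only [vecCut, G.adj_comm c, h1]
    | zero => rfl
    | add x y _ _ hx hy => simp only [Pi.add_apply, hx, hy]
    | smul a x _ hx => simp only [Pi.smul_apply, hx]
  ext y
  simp only [Finset.mem_inter, SimpleGraph.mem_neighborFinset]
  refine and_congr_left fun hy => ?_
  have h2 := key (vecCut G Y y) (hs ▸ Submodule.subset_span ⟨y, hy, rfl⟩)
  simp only [vecCut, G.adj_comm y] at h2
  by_cases a : G.Adj v y <;> by_cases b : G.Adj w y <;> simp_all

/-- Let `(A, B)` be a split pair for `X ⊆ V(G)`.  If `v, w ∈ X` satisfy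
`N(v) ∩ B = N(w) ∩ B` then `v ≈_X w`, i.e. `N(v) ∩ X̄ = N(w) ∩ X̄`; and if `v', w' ∈ X̄`
satisfy `N(v') ∩ A = N(w') ∩ A` then `v' ≈_X̄ w'`, i.e. `N(v') ∩ X = N(w') ∩ X`. -/
theorem splitPair_neighbors_determined {V : Type} [Fintype V] [DecidableEq V]
    (G : SimpleGraph V) [DecidableRel G.Adj] (X A B : Finset V) (h : IsSplitPair G X A B) :
    (∀ v ∈ X, ∀ w ∈ X, G.neighborFinset v ∩ B = G.neighborFinset w ∩ B →
      G.neighborFinset v ∩ Xᶜ = G.neighborFinset w ∩ Xᶜ) ∧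
    (∀ v' ∈ Xᶜ, ∀ w' ∈ Xᶜ, G.neighborFinset v' ∩ A = G.neighborFinset w' ∩ A →
      G.neighborFinset v' ∩ X = G.neighborFinset w' ∩ X) := by
  obtain ⟨hA, hB, ⟨-, h1⟩, ⟨-, h2⟩⟩ := h
  refine ⟨fun v hv w hw e => ?_, fun v hv w hw e => vecCut_key G X A h1 hA v w hv hw e⟩
  exact vecCut_key G Xᶜ B h2 hB v w (by simpa using hv) (by simpa using hw) e
end

section
/- Let G be a finite simple graph, X ⊆ V(G), and (ā, b̄) an ordered split pair for X. Individualize the vertices of ā and b̄ and run two rounds of Color Refinement. Then for all u, w ∈ X with χ^{(ā,b̄),G}_{1,2}(u) = χ^{(ā,b̄),G}_{1,2}(w), one has u ≈_X w; and for all u', w' ∈ X̄ with χ^{(ā,b̄),G}_{1,2}(u') = χ^{(ā,b̄),G}_{1,2}(w'), one has u' ≈_{X̄} w'. -/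
/-- The type of color values computed by Color Refinement (1-dimensional WL) after `r`
refinement steps (index `0` is the initial coloring, so index `r` corresponds to `r + 1`
rounds in the convention where the initial coloring is round one). -/
def CRColorType (C : Type) : ℕ → Type
  | 0 => C × ℕ
  | (r + 1) => CRColorType C r × Multiset (CRColorType C r)

/-- Color Refinement on a vertex-colored graph `(G, χ)`:
`crColor G χ 0 u = (χ u, deg u)` and
`crColor G χ (r+1) u = (crColor G χ r u, {{crColor G χ r x : x ∈ N(u)}})`. -/
def crColor {V C : Type} [Fintype V] (G : SimpleGraph V) [DecidableRel G.Adj] (χ : V → C) :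
    (r : ℕ) → V → CRColorType C r
  | 0 => fun u => (χ u, G.degree u)
  | (r + 1) => fun u => (crColor G χ r u, (G.neighborFinset u).val.map (crColor G χ r))

theorem cut_aux {V : Type} [Fintype V] [DecidableEq V] (G : SimpleGraph V) [DecidableRel G.Adj]
    (Y : Finset V) (B : Set V)
    (hs : Submodule.span (ZMod 2) (vecCut G Y '' B) = Submodule.span (ZMod 2) (vecCut G Y '' ↑Y))
    (u w : V) (hu : u ∈ Yᶜ) (hw : w ∈ Yᶜ) (hB : ∀ b ∈ B, G.Adj b u ↔ G.Adj b w) :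
    G.neighborFinset u ∩ Y = G.neighborFinset w ∩ Y := by
  have key : Submodule.span (ZMod 2) (vecCut G Y '' B) ≤
      LinearMap.ker ((LinearMap.proj ⟨u, hu⟩ : (↥(Yᶜ) → ZMod 2) →ₗ[ZMod 2] ZMod 2) -
        LinearMap.proj ⟨w, hw⟩) := by
    rw [Submodule.span_le]
    rintro _ ⟨b, hb, rfl⟩
    have := hB b hb
    simp [vecCut, this]
  rw [hs] at key
  ext y
  simp only [Finset.mem_inter, SimpleGraph.mem_neighborFinset]
  refine and_congr_left fun hy => ?_
  have h1 := key (Submodule.subset_span ⟨y, hy, rfl⟩)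
  rw [G.adj_comm u, G.adj_comm w]
  by_cases p : G.Adj y u <;> by_cases q : G.Adj y w <;> simp_all [vecCut]

theorem color_aux {V C : Type} [Fintype V] (G : SimpleGraph V) [DecidableRel G.Adj] (χ : V → C)
    (u w v : V) (hv : ∀ x, χ x = χ v → x = v) (h : crColor G χ 1 u = crColor G χ 1 w)
    (hu : G.Adj v u) : G.Adj v w := by
  have h2 : (G.neighborFinset u).val.map (crColor G χ 0) =
      (G.neighborFinset w).val.map (crColor G χ 0) := congrArg Prod.snd h
  have hm : crColor G χ 0 v ∈ (G.neighborFinset u).val.map (crColor G χ 0) :=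
    Multiset.mem_map_of_mem _ (by simpa using hu.symm)
  rw [h2, Multiset.mem_map] at hm
  obtain ⟨x, hx, e⟩ := hm
  have e' : χ x = χ v := congrArg Prod.fst e
  rw [hv x e'] at hx
  have hx' : G.Adj w v := by simpa using hx
  exact hx'.symm

/-- Let `(ā, b̄)` be an ordered split pair for `X ⊆ V(G)` (a pair of tuples
whose underlying sets form a split pair for `X`).  Individualize the vertices of `ā` and `b̄`
(here: color each vertex `x` by the predicates `x = aᵢ`, `x = bᵢ`, which gives each vertex of
the tuples a fresh unique color) and run two rounds of Color Refinement (index `1`).  Then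
vertices of `X` with equal colors satisfy `≈_X`, and vertices of `X̄` with equal colors
satisfy `≈_X̄`. -/
theorem colorRefinement_individualized_splitPair {V : Type} [Fintype V] [DecidableEq V]
    (G : SimpleGraph V) [DecidableRel G.Adj] (X : Finset V) {m : ℕ} (a b : Fin m → V)
    (h : IsSplitPair G X (Finset.image a Finset.univ) (Finset.image b Finset.univ)) :
    (∀ u ∈ X, ∀ w ∈ X,
      crColor G (fun x => ((fun i => x = a i, fun i => x = b i) :
        (Fin m → Prop) × (Fin m → Prop))) 1 u =
        crColor G (fun x => ((fun i => x = a i, fun i => x = b i) :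
          (Fin m → Prop) × (Fin m → Prop))) 1 w →
      G.neighborFinset u ∩ Xᶜ = G.neighborFinset w ∩ Xᶜ) ∧
    (∀ u' ∈ Xᶜ, ∀ w' ∈ Xᶜ,
      crColor G (fun x => ((fun i => x = a i, fun i => x = b i) :
        (Fin m → Prop) × (Fin m → Prop))) 1 u' =
        crColor G (fun x => ((fun i => x = a i, fun i => x = b i) :
          (Fin m → Prop) × (Fin m → Prop))) 1 w' →
      G.neighborFinset u' ∩ X = G.neighborFinset w' ∩ X) := by
  obtain ⟨-, -, ⟨-, hA⟩, ⟨-, hB⟩⟩ := h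
  constructor
  · intro u hu w hw e
    refine cut_aux G Xᶜ _ hB u w (by simpa using hu) (by simpa using hw) ?_
    intro v hv
    obtain ⟨i, rfl⟩ : ∃ i, b i = v := by simpa using hv
    have hc := fun x (hx : ((fun i => x = a i, fun i => x = b i) :
        (Fin m → Prop) × (Fin m → Prop)) = (fun j => b i = a j, fun j => b i = b j)) =>
      (congrFun (congrArg Prod.snd hx) i).mpr rfl
    exact ⟨color_aux G _ u w _ hc e, color_aux G _ w u _ hc e.symm⟩
  · intro u hu w hw e
    refine cut_aux G X _ hA u w hu hw ?_
    intro v hv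
    obtain ⟨i, rfl⟩ : ∃ i, a i = v := by simpa using hv
    have hc := fun x (hx : ((fun i => x = a i, fun i => x = b i) :
        (Fin m → Prop) × (Fin m → Prop)) = (fun j => a i = a j, fun j => a i = b j)) =>
      (congrFun (congrArg Prod.fst hx) i).mpr rfl
    exact ⟨color_aux G _ u w _ hc e, color_aux G _ w u _ hc e.symm⟩
end

section
/- Let G and H be finite simple graphs that are not isomorphic, let 𝒫 be a component partition of G and 𝒬 a component partition of H, and let σ : V(G) → V(H) be a bijection. Then there exists a vertex v ∈ V(G) such that G[P] ≇ H[Q], where P ∈ 𝒫 is the unique block containing v and Q ∈ 𝒬 is the unique block containing σ(v). -/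
/-- `P` is a component partition of the graph `G`: a partition of `V(G)` such that every
connected component of `G` is contained in exactly one block.  (Since the blocks of a
partition are pairwise disjoint and components are nonempty, containment in *some* block is
automatically containment in exactly one.) -/
def IsCompPartition {V : Type} [Fintype V] (G : SimpleGraph V) (P : Finset (Finset V)) :
    Prop :=
  (∀ v : V, ∃! p, p ∈ P ∧ v ∈ p) ∧
    ∀ c : G.ConnectedComponent, ∃ p ∈ P, c.supp ⊆ ↑p

theorem glue_iso {V W A B : Type} (G : SimpleGraph V) (H : SimpleGraph W) (f : V → A) (g : W → B)
    (hf : ∀ u v, G.Adj u v → f u = f v) (hg : ∀ u v, H.Adj u v → g u = g v) (e : A ≃ B)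
    (φ : ∀ a, G.induce {v | f v = a} ≃g H.induce {w | g w = e a}) : Nonempty (G ≃g H) := by
  let F : V → W := fun v => (φ (f v) ⟨v, rfl⟩).1
  have hF : ∀ a u (h : f u = a), F u = (φ a ⟨u, h⟩).1 := by
    rintro a u rfl; rfl
  have hgF : ∀ v, g (F v) = e (f v) := fun v => (φ (f v) ⟨v, rfl⟩).2
  have hinj : Function.Injective F := by
    intro u v h
    have h1 : f u = f v := e.injective (by rw [← hgF, ← hgF, h])
    rw [hF _ u h1, hF _ v rfl] at h
    have := (φ (f v)).injective (Subtype.ext h)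
    exact congrArg Subtype.val this
  have hsurj : Function.Surjective F := by
    intro w
    let x := (φ (e.symm (g w))).symm ⟨w, by simp⟩
    refine ⟨x.1, ?_⟩
    rw [hF _ x.1 x.2]
    simp [x]
  refine ⟨⟨Equiv.ofBijective F ⟨hinj, hsurj⟩, ?_⟩⟩
  intro u v
  change H.Adj (F u) (F v) ↔ G.Adj u v
  by_cases h : f u = f v
  · rw [hF _ u h, hF _ v rfl]
    exact (φ (f v)).map_adj_iff (v := ⟨u, h⟩) (w := ⟨v, rfl⟩)
  · constructor
    · intro h'
      have := hg _ _ h'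
      rw [hgF, hgF] at this
      exact absurd (e.injective this) h
    · intro h'
      exact absurd (hf _ _ h') h

theorem card_fib {V A C : Type} [Fintype V] [Fintype A] [DecidableEq A] [DecidableEq C]
    (f : V → A) (c : A → C) (k : C) (n : ℕ)
    (h : ∀ a, c a = k → (Finset.univ.filter (fun v => f v = a)).card = n) :
    (Finset.univ.filter (fun v => c (f v) = k)).card =
      (Finset.univ.filter (fun a => c a = k)).card * n := by
  rw [Finset.card_eq_sum_card_fiberwise (f := f) (t := Finset.univ.filter (fun a => c a = k))]
  · rw [Finset.sum_const_nat]
    intro a ha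
    simp only [Finset.mem_filter, Finset.mem_univ, true_and] at ha
    rw [← h a ha, Finset.filter_filter]
    congr 1
    ext v
    simp only [Finset.mem_filter, Finset.mem_univ, true_and]
    constructor
    · exact fun h => h.2
    · rintro rfl; exact ⟨ha, rfl⟩
  · intro v hv
    simpa using hv

theorem exists_match {V W A B : Type} [Fintype V] [Fintype W] [Fintype A] [Fintype B]
    (G : SimpleGraph V) (H : SimpleGraph W) (f : V → A) (g : W → B)
    (hf : Function.Surjective f) (hg : Function.Surjective g) (σ : V ≃ W)
    (h : ∀ v, Nonempty (G.induce {u | f u = f v} ≃g H.induce {w | g w = g (σ v)})) :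
    ∃ e : A ≃ B, ∀ a, Nonempty (G.induce {v | f v = a} ≃g H.induce {w | g w = e a}) := by
  classical
  let cA : A → Set A := fun a => {a' | Nonempty (G.induce {u | f u = a'} ≃g G.induce {u | f u = a})}
  let cB : B → Set A := fun b => {a' | Nonempty (G.induce {u | f u = a'} ≃g H.induce {w | g w = b})}
  have hAB : ∀ a b, cA a = cB b → Nonempty (G.induce {v | f v = a} ≃g H.induce {w | g w = b}) := by
    intro a b hab
    have : a ∈ cA a := ⟨SimpleGraph.Iso.refl⟩
    rw [hab] at this
    exact this
  have hBA : ∀ v, cA (f v) = cB (g (σ v)) := by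
    intro v
    obtain ⟨i⟩ := h v
    ext a'
    exact ⟨fun ⟨j⟩ => ⟨j.trans i⟩, fun ⟨j⟩ => ⟨j.trans i.symm⟩⟩
  have key : ∀ k, Nonempty ({a // cA a = k} ≃ {b // cB b = k}) := by
    intro k
    apply Fintype.card_eq.mp
    rw [Fintype.card_subtype, Fintype.card_subtype]
    by_cases hk : ∃ v, cA (f v) = k
    · obtain ⟨v, hv⟩ := hk
      have hcardB : ∀ b, cB b = k → (Finset.univ.filter (fun w => g w = b)).card =
          (Finset.univ.filter (fun u => f u = f v)).card := by
        intro b hb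
        obtain ⟨i⟩ := hAB (f v) b (hv.trans hb.symm)
        rw [← Fintype.card_subtype, ← Fintype.card_subtype]
        exact (Fintype.card_congr i.toEquiv).symm
      have hcardA : ∀ a, cA a = k → (Finset.univ.filter (fun u => f u = a)).card =
          (Finset.univ.filter (fun u => f u = f v)).card := by
        intro a ha
        obtain ⟨u, rfl⟩ := hf a
        rw [← hcardB (g (σ u)) ((hBA u).symm.trans ha)]
        obtain ⟨i⟩ := h u
        rw [← Fintype.card_subtype, ← Fintype.card_subtype]
        exact (Fintype.card_congr i.toEquiv)
      have h1 := card_fib f cA k _ hcardA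
      have h2 := card_fib g cB k _ hcardB
      have h3 : (Finset.univ.filter (fun v => cA (f v) = k)).card =
          (Finset.univ.filter (fun w => cB (g w) = k)).card := by
        rw [← Fintype.card_subtype, ← Fintype.card_subtype]
        exact Fintype.card_congr (σ.subtypeEquiv (fun u => by rw [hBA]))
      rw [h1, h2] at h3
      refine Nat.eq_of_mul_eq_mul_right ?_ h3
      exact Finset.card_pos.mpr ⟨v, by simp⟩
    · push Not at hk
      rw [Finset.card_eq_zero.mpr, Finset.card_eq_zero.mpr]
      · refine Finset.filter_eq_empty_iff.mpr ?_
        intro b _ hb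
        obtain ⟨w, rfl⟩ := hg b
        apply hk (σ.symm w)
        rw [hBA]; simpa using hb
      · refine Finset.filter_eq_empty_iff.mpr ?_
        intro a _ ha
        obtain ⟨u, rfl⟩ := hf a
        exact hk u ha
  let E := fun k => Classical.choice (key k)
  let e : A ≃ B := (Equiv.sigmaFiberEquiv cA).symm.trans
    ((Equiv.sigmaCongrRight E).trans (Equiv.sigmaFiberEquiv cB))
  refine ⟨e, fun a => hAB a (e a) ?_⟩
  exact ((E (cA a)) ⟨a, rfl⟩).2.symm

theorem exists_blocks {V : Type} [Fintype V] (G : SimpleGraph V) (P : Finset (Finset V))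
    (hP : IsCompPartition G P) :
    ∃ f : V → {p : Finset V // p ∈ P ∧ p.Nonempty}, Function.Surjective f ∧
      (∀ u v, G.Adj u v → f u = f v) ∧ ∀ p ∈ P, ∀ v ∈ p, (p : Set V) = {u | f u = f v} := by
  obtain ⟨h1, h2⟩ := hP
  choose b hb hu using h1
  simp only at hb hu
  have hu' : ∀ p ∈ P, ∀ v ∈ p, p = b v := fun p hp v hv => hu v p ⟨hp, hv⟩
  refine ⟨fun v => ⟨b v, (hb v).1, v, (hb v).2⟩, ?_, ?_, ?_⟩
  · rintro ⟨p, hp, v, hv⟩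
    exact ⟨v, Subtype.ext (hu' p hp v hv).symm⟩
  · intro u v huv
    obtain ⟨p, hp, hs⟩ := h2 (G.connectedComponentMk u)
    have hu1 : u ∈ p := hs (by simp)
    have hv1 : v ∈ p := hs (by simpa using huv.symm.reachable)
    exact Subtype.ext ((hu' p hp u hu1).symm.trans (hu' p hp v hv1))
  · intro p hp v hv
    ext u
    simp only [Finset.mem_coe, Set.mem_setOf_eq, Subtype.mk.injEq]
    rw [← hu' p hp v hv]
    constructor
    · intro h; exact (hu' p hp u h).symm
    · intro h; rw [← h]; exact (hb u).2

/-- Let `G ≇ H` be graphs, `𝒫`, `𝒬` component partitions of `G`, `H`, and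
`σ : V(G) → V(H)` a bijection.  Then there is a vertex `v` such that `G[P] ≇ H[Q]`, where
`P` is the (unique) block of `𝒫` containing `v` and `Q` the (unique) block of `𝒬`
containing `σ(v)`. -/
theorem component_partition_witness {V W : Type} [Fintype V] [DecidableEq V] [Fintype W]
    [DecidableEq W] (G : SimpleGraph V) (H : SimpleGraph W) (hGH : ¬ Nonempty (G ≃g H))
    (P : Finset (Finset V)) (Q : Finset (Finset W))
    (hP : IsCompPartition G P) (hQ : IsCompPartition H Q) (σ : V ≃ W) :
    ∃ v : V, ∀ p ∈ P, v ∈ p → ∀ q ∈ Q, σ v ∈ q →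
      ¬ Nonempty (G.induce (↑p : Set V) ≃g H.induce (↑q : Set W)) := by
  by_contra hcon
  push Not at hcon
  obtain ⟨f, hf, hfa, hfp⟩ := exists_blocks G P hP
  obtain ⟨g, hg, hga, hgp⟩ := exists_blocks H Q hQ
  obtain ⟨e, he⟩ := exists_match G H f g hf hg σ (by
    intro v
    obtain ⟨p, hp, hv, q, hq, hw, i⟩ := hcon v
    rwa [hfp p hp v hv, hgp q hq _ hw] at i)
  let φ := fun a => Classical.choice (he a)
  exact hGH (glue_iso G H f g hfa hga e φ)
end
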